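/- Let (R,𝔪) be a finite commutative local ring with identity, with maximal ideal of size |𝔪| = q^β and residue field R/𝔪 of size q = p^r (p prime), where gcd(4,|R|) = 1 and q ≡ 1 (mod 8). Let e, f ∈ ℤ with q = e² + 4f², e ≡ 1 (mod 4), and p not dividing e when p ≡ 1 (mod 4); and let u, v ∈ ℤ with q = u² + 2v², u ≡ 3 (mod 4), and p not dividing u when p ≡ 1 or 3 (mod 8). Let χ₄ be a multiplicative character of 𝔽_q of order 4, φ the multiplicative character of order 2, and ε the trivial character. Then K_4(G_R(4)) = (q^(4β+1)(q−1) / (2¹⁵ · 3)) · [ q² − 2q(15e + 101) + 304e² + (930 − 40u)e + 801 + 120u² + 12q² · ₃F₂(χ₄, χ₄, χ̄₄; ε, ε; 1)_q + 30q² · ₃F₂(χ₄, φ, φ; ε, ε; 1)_q ]. -/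

import Mathlib

open Complex

/-- The number of cliques of size `n` in a graph `G`. -/
noncomputable def SimpleGraph.cliqueCount {V : Type*} (G : SimpleGraph V) (n : ℕ) : ℕ :=
  Nat.card {s : Finset V // G.IsNClique n s}

/-- The `k`-unitary Cayley graph `G_R(k)` of a commutative ring `R`: distinct `x, y ∈ R` are
adjacent iff `y - x = u^k` for some unit `u ∈ R^*` (symmetrized; under the hypotheses of the
theorem below this relation is already symmetric). -/
def unitaryCayleyGraph (R : Type*) [CommRing R] (k : ℕ) : SimpleGraph R :=
  SimpleGraph.fromRel fun x y => ∃ u : Rˣ, y - x = (u : R) ^ k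

/-- The binomial symbol `(ψ choose χ) = (ψ(-1)/q) · J(χ, conj ψ)`, where
`J(χ,ψ') = Σ_a χ(a) ψ'(1-a)` is the Jacobi sum. -/
noncomputable def charBinom {F : Type*} [Field F] [Fintype F] (ψ χ : MulChar F ℂ) : ℂ :=
  ψ (-1) / (Fintype.card F : ℂ) *
    jacobiSum χ (ψ.ringHomComp (starRingEnd ℂ))

/-- The hypergeometric sum `₃F₂(A,B,C;D,E;1)_q`, a sum over all multiplicative characters
`χ` of `F`. -/
noncomputable def hyp3F2 {F : Type*} [Field F] [Fintype F]
    (A B C D E : MulChar F ℂ) : ℂ :=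
  (Fintype.card F : ℂ) / ((Fintype.card F : ℂ) - 1) *
    ∑ᶠ χ : MulChar F ℂ,
      charBinom (A * χ) χ * charBinom (B * χ) (D * χ) * charBinom (C * χ) (E * χ) * χ 1


section PartA
variable {F : Type*} [Field F] [Fintype F]

/-- The basic two-variable character sum. -/
noncomputable def TT (A B C D K : MulChar F ℂ) : ℂ :=
  ∑ x : F, ∑ y : F, A x * B (1 - x) * C y * D (1 - y) * K (x - y)

lemma mc_neg {A : MulChar F ℂ} (hA : A (-1) = 1) (x : F) : A (-x) = A x := by
  rw [← neg_one_mul, map_mul, hA, one_mul]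

lemma mc_sub {A : MulChar F ℂ} (hA : A (-1) = 1) (x y : F) : A (x - y) = A (y - x) := by
  rw [← mc_neg hA, neg_sub]

lemma mc_inv_mul (A : MulChar F ℂ) {x : F} (hx : x ≠ 0) : A⁻¹ x * A x = 1 := by
  rw [MulChar.inv_apply', ← map_mul, inv_mul_cancel₀ hx, map_one]

lemma mc_inv (A : MulChar F ℂ) (x : F) : A x⁻¹ = A⁻¹ x := (MulChar.inv_apply' A x).symm

lemma TT_s1 (A B C D K : MulChar F ℂ) (hK : K (-1) = 1) :
    TT A B C D K = TT C D A B K := by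
  unfold TT
  rw [Finset.sum_comm]
  refine Finset.sum_congr rfl fun x _ => Finset.sum_congr rfl fun y _ => ?_
  rw [mc_sub hK]; ring

lemma TT_s2 (A B C D K : MulChar F ℂ) (hK : K (-1) = 1) :
    TT A B C D K = TT B A D C K := by
  unfold TT
  refine Fintype.sum_equiv (Equiv.subLeft 1) _ _ fun x => ?_
  refine Fintype.sum_equiv (Equiv.subLeft 1) _ _ fun y => ?_
  simp only [Equiv.subLeft_apply, sub_sub_cancel]
  rw [show (1 - x - (1 - y)) = y - x by ring, mc_sub hK]; ring

lemma TT_s3 (A B C D K : MulChar F ℂ) (hB : B (-1) = 1) (hD : D (-1) = 1)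
    (hK : K (-1) = 1) :
    TT A B C D K = TT (A * B * K)⁻¹ B (C * D * K)⁻¹ D K := by
  unfold TT
  refine Fintype.sum_equiv (Equiv.inv F) _ _ fun x => ?_
  refine Fintype.sum_equiv (Equiv.inv F) _ _ fun y => ?_
  simp only [Equiv.inv_apply]
  by_cases hx : x = 0
  · simp [hx, MulChar.map_zero]
  by_cases hy : y = 0
  · simp [hy, MulChar.map_zero]
  rw [show (1 - x⁻¹) = -((1 - x) * x⁻¹) by field_simp; ring,
    show (1 - y⁻¹) = -((1 - y) * y⁻¹) by field_simp; ring,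
    show (x⁻¹ - y⁻¹) = -((x - y) * x⁻¹ * y⁻¹) by field_simp; ring,
    mc_neg hB, mc_neg hD, mc_neg hK]
  simp only [mul_inv, MulChar.mul_apply, map_mul, mc_inv, inv_inv]
  have h1 := mc_inv_mul B hx
  have h2 := mc_inv_mul D hy
  have h3 := mc_inv_mul K hx
  have h4 := mc_inv_mul K hy
  linear_combination -(A x * B (1-x) * C y * D (1-y) * K (x-y)) *
    (B⁻¹ x * B x * (D⁻¹ y * D y) * (K⁻¹ x * K x) * h4 + B⁻¹ x * B x * (D⁻¹ y * D y) * h3 +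
     B⁻¹ x * B x * h2 + h1)

lemma TT_s4 (A B C D K : MulChar F ℂ) (hB : B (-1) = 1) (hD : D (-1) = 1)
    (hK : K (-1) = 1) :
    TT A B C D K = TT A K (A * B * C * D * K)⁻¹ D B := by
  unfold TT
  rw [Finset.sum_comm]
  conv_rhs => rw [Finset.sum_comm]
  refine Fintype.sum_equiv (Equiv.inv F) _ _ fun y => ?_
  simp only [Equiv.inv_apply]
  by_cases hy : y = 0
  · simp [hy, MulChar.map_zero]
  refine Fintype.sum_equiv (Equiv.mulRight₀ y⁻¹ (inv_ne_zero hy)) _ _ fun x => ?_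
  simp only [Equiv.mulRight₀_apply]
  rw [show (1 - y⁻¹) = -((1 - y) * y⁻¹) by field_simp; ring,
    show (1 - x * y⁻¹) = -((x - y) * y⁻¹) by field_simp; ring,
    show (x * y⁻¹ - y⁻¹) = -((1 - x) * y⁻¹) by field_simp; ring,
    mc_neg hB, mc_neg hD, mc_neg hK]
  simp only [mul_inv, MulChar.mul_apply, map_mul, mc_inv, inv_inv]
  have h1 := mc_inv_mul A hy
  have h2 := mc_inv_mul B hy
  have h3 := mc_inv_mul D hy
  have h4 := mc_inv_mul K hy
  linear_combination -(A x * B (1-x) * C y * D (1-y) * K (x-y)) *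
    (A⁻¹ y * A y * (B⁻¹ y * B y) * (D⁻¹ y * D y) * h4 + A⁻¹ y * A y * (B⁻¹ y * B y) * h3 +
     A⁻¹ y * A y * h2 + h1)

lemma TT_zero (A B C D : MulChar F ℂ) :
    TT A B C D 1 = jacobiSum A B * jacobiSum C D - jacobiSum (A * C) (B * D) := by
  classical
  unfold TT jacobiSum
  rw [Finset.sum_mul_sum, ← Finset.sum_sub_distrib]
  refine Finset.sum_congr rfl fun x _ => ?_
  have : ∀ y : F, A x * B (1 - x) * C y * D (1 - y) * (1 : MulChar F ℂ) (x - y) =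
      A x * B (1 - x) * (C y * D (1 - y)) -
      if x = y then A x * B (1 - x) * (C y * D (1 - y)) else 0 := by
    intro y
    split_ifs with h
    · simp [h, MulChar.map_zero]
    · rw [MulChar.one_apply (isUnit_iff_ne_zero.mpr (sub_ne_zero.mpr h))]; ring
  simp only [this, Finset.sum_sub_distrib, Finset.sum_ite_eq, Finset.mem_univ, if_true,
    MulChar.mul_apply]
  ring
end PartA


section PartB

/-- Formal linear combinations of the monomials that occur. -/
structure Lin where
  c1 : ℤ
  cq : ℤ
  cp : ℤ
  cP : ℤ
  cqq : ℤ
  cqp : ℤ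
  cqP : ℤ
  cpp : ℤ
  cpP : ℤ
  cPP : ℤ
  cH : ℤ
  cK : ℤ
  cPhi : ℤ
  cB : ℤ
  cU : ℤ
  cV : ℤ
deriving DecidableEq

def Lin.add (x y : Lin) : Lin :=
  ⟨x.c1 + y.c1, x.cq + y.cq, x.cp + y.cp, x.cP + y.cP, x.cqq + y.cqq, x.cqp + y.cqp,
    x.cqP + y.cqP, x.cpp + y.cpp, x.cpP + y.cpP, x.cPP + y.cPP, x.cH + y.cH, x.cK + y.cK,
    x.cPhi + y.cPhi, x.cB + y.cB, x.cU + y.cU, x.cV + y.cV⟩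

/-- linear forms in `1, q, p, P` -/
structure Lin1 where
  c1 : ℤ
  cq : ℤ
  cp : ℤ
  cP : ℤ

def Lin1.prodSub (x y z : Lin1) : Lin :=
  ⟨x.c1 * y.c1 - z.c1, x.c1 * y.cq + x.cq * y.c1 - z.cq, x.c1 * y.cp + x.cp * y.c1 - z.cp,
    x.c1 * y.cP + x.cP * y.c1 - z.cP, x.cq * y.cq, x.cq * y.cp + x.cp * y.cq,
    x.cq * y.cP + x.cP * y.cq, x.cp * y.cp, x.cp * y.cP + x.cP * y.cp, x.cP * y.cP,
    0, 0, 0, 0, 0, 0⟩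

noncomputable def Lin.ev (q p P H K Phi B U V : ℂ) (x : Lin) : ℂ :=
  x.c1 + x.cq * q + x.cp * p + x.cP * P + x.cqq * (q * q) + x.cqp * (q * p) + x.cqP * (q * P) +
    x.cpp * (p * p) + x.cpP * (p * P) + x.cPP * (P * P) + x.cH * H + x.cK * K + x.cPhi * Phi +
    x.cB * B + x.cU * U + x.cV * V

noncomputable def Lin1.ev (q p P : ℂ) (x : Lin1) : ℂ :=
  x.c1 + x.cq * q + x.cp * p + x.cP * P

lemma Lin.ev_add (q p P H K Phi B U V : ℂ) (x y : Lin) :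
    (x.add y).ev q p P H K Phi B U V =
      x.ev q p P H K Phi B U V + y.ev q p P H K Phi B U V := by
  simp only [Lin.ev, Lin.add]; push_cast; ring

lemma Lin1.ev_prodSub (q p P H K Phi B U V : ℂ) (x y z : Lin1) :
    (Lin1.prodSub x y z).ev q p P H K Phi B U V =
      x.ev q p P * y.ev q p P - z.ev q p P := by
  simp only [Lin.ev, Lin1.prodSub, Lin1.ev]; push_cast; ring

/-- table of quartic Jacobi sums; indices are reduced mod 4 -/
def jl (a b : ℕ) : Lin1 :=
  match a % 4, b % 4 with
  | 0, 0 => ⟨-2, 1, 0, 0⟩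
  | 0, _ => ⟨-1, 0, 0, 0⟩
  | _, 0 => ⟨-1, 0, 0, 0⟩
  | 1, 1 => ⟨0, 0, 1, 0⟩
  | 1, 2 => ⟨0, 0, 1, 0⟩
  | 2, 1 => ⟨0, 0, 1, 0⟩
  | 2, 3 => ⟨0, 0, 0, 1⟩
  | 3, 2 => ⟨0, 0, 0, 1⟩
  | 3, 3 => ⟨0, 0, 0, 1⟩
  | _, _ => ⟨-1, 0, 0, 0⟩

/-- walk along a list of symmetries until the sum is of known type -/
def walk : List ℕ → ℕ → ℕ → ℕ → ℕ → ℕ → Option Lin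
  | path, a, b, c, d, k =>
    match k with
    | 0 => some (Lin1.prodSub (jl a b) (jl c d) (jl (a + c) (b + d)))
    | k' + 1 =>
      match a, b, c, d, k' with
      | 2, 1, 2, 2, 1 => some ⟨0,0,0,0,0,0,0,0,0,0,1,0,0,0,0,0⟩
      | 1, 1, 3, 1, 2 => some ⟨0,0,0,0,0,0,0,0,0,0,0,1,0,0,0,0⟩
      | 2, 2, 2, 2, 1 => some ⟨0,0,0,0,0,0,0,0,0,0,0,0,1,0,0,0⟩
      | 3, 2, 3, 2, 0 => some ⟨0,0,0,0,0,0,0,0,0,0,0,0,0,1,0,0⟩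
      | 1, 1, 1, 1, 0 => some ⟨0,0,0,0,0,0,0,0,0,0,0,0,0,0,1,0⟩
      | 3, 3, 3, 3, 2 => some ⟨0,0,0,0,0,0,0,0,0,0,0,0,0,0,0,1⟩
      | _, _, _, _, _ =>
        match path with
        | [] => none
        | 0 :: l => walk l c d a b k
        | 1 :: l => walk l b a d c k
        | 2 :: l => walk l (3 * (a + b + k) % 4) b (3 * (c + d + k) % 4) d k
        | _ :: l => walk l a k (3 * (a + b + c + d + k) % 4) d b

def thePath : List ℕ := [3, 1, 3, 0, 3, 1, 3, 0, 3, 2, 1, 3, 0, 3, 1, 3, 2, 1, 3, 1, 2, 0, 1,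
  3, 1, 3, 3, 0, 1, 3, 1, 2, 1, 3, 1, 2, 0, 1, 3, 1, 2, 3, 1, 0, 3, 2]

def addO (x y : Option Lin) : Option Lin :=
  match x, y with
  | some x, some y => some (x.add y)
  | _, _ => none

def tot4 (f : ℕ → Option Lin) : Option Lin := addO (addO (addO (f 0) (f 1)) (f 2)) (f 3)

lemma total_eq : (tot4 fun a => tot4 fun b => tot4 fun c => tot4 fun d => tot4 fun k =>
    walk thePath a b c d k) =
    some ⟨801, -68, -465, -465, 1, 15, 15, 75, 78, 75, 30, 12, 1, 30, 10, 10⟩ := by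
  decide +kernel


lemma walk_spec (T : ℕ → ℕ → ℕ → ℕ → ℕ → ℂ) (q p P : ℂ)
    (h1 : ∀ a b c d k, T a b c d k = T c d a b k)
    (h2 : ∀ a b c d k, T a b c d k = T b a d c k)
    (h3 : ∀ a b c d k, T a b c d k = T (3 * (a + b + k) % 4) b (3 * (c + d + k) % 4) d k)
    (h4 : ∀ a b c d k, T a b c d k = T a k (3 * (a + b + c + d + k) % 4) d b)
    (h0 : ∀ a b c d, T a b c d 0 =
      (jl a b).ev q p P * (jl c d).ev q p P - (jl (a + c) (b + d)).ev q p P) :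
    ∀ (path : List ℕ) (a b c d k : ℕ) (r : Lin), walk path a b c d k = some r →
      T a b c d k = r.ev q p P (T 2 1 2 2 2) (T 1 1 3 1 3) (T 2 2 2 2 2) (T 3 2 3 2 1)
        (T 1 1 1 1 1) (T 3 3 3 3 3) := by
  intro path
  induction path with
  | nil =>
    intro a b c d k r h
    unfold walk at h
    split at h
    · obtain rfl := Option.some.inj h
      rw [Lin1.ev_prodSub, h0]
    · split at h
      all_goals first
        | (obtain rfl := Option.some.inj h; simp [Lin.ev])
        | (simp at h)
  | cons g l ih =>
    intro a b c d k r h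
    unfold walk at h
    split at h
    · obtain rfl := Option.some.inj h
      rw [Lin1.ev_prodSub, h0]
    · split at h
      iterate 6 (obtain rfl := Option.some.inj h; simp [Lin.ev])
      split at h
      · cases h
      · rename_i hl; cases hl
        rw [h1]; exact ih _ _ _ _ _ _ h
      · rename_i hl; cases hl
        rw [h2]; exact ih _ _ _ _ _ _ h
      · rename_i hl; cases hl
        rw [h3]; exact ih _ _ _ _ _ _ h
      · rename_i hl; cases hl
        rw [h4]; exact ih _ _ _ _ _ _ h

lemma addO_spec (e : Lin → ℂ) (he : ∀ x y, e (x.add y) = e x + e y) {x y : Option Lin} {r : Lin}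
    (h : addO x y = some r) : ∃ s t, x = some s ∧ y = some t ∧ e r = e s + e t := by
  rcases x with _ | s
  · simp [addO] at h
  rcases y with _ | t
  · simp [addO] at h
  simp only [addO, Option.some.injEq] at h
  exact ⟨s, t, rfl, rfl, by rw [← h, he]⟩

lemma tot4_spec (e : Lin → ℂ) (he : ∀ x y, e (x.add y) = e x + e y) {f : ℕ → Option Lin}
    {g : ℕ → ℂ} (hfg : ∀ a r, f a = some r → g a = e r) {r : Lin} (h : tot4 f = some r) :
    ∑ a ∈ Finset.range 4, g a = e r := by
  obtain ⟨s, t3, hs, h3, e3⟩ := addO_spec e he h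
  obtain ⟨s, t2, hs, h2, e2⟩ := addO_spec e he hs
  obtain ⟨t0, t1, h0, h1, e1⟩ := addO_spec e he hs
  simp only [Finset.sum_range_succ, Finset.sum_range_zero, zero_add]
  rw [e3, e2, e1, hfg _ _ h0, hfg _ _ h1, hfg _ _ h2, hfg _ _ h3]

lemma total_spec (T : ℕ → ℕ → ℕ → ℕ → ℕ → ℂ) (q p P : ℂ)
    (h1 : ∀ a b c d k, T a b c d k = T c d a b k)
    (h2 : ∀ a b c d k, T a b c d k = T b a d c k)
    (h3 : ∀ a b c d k, T a b c d k = T (3 * (a + b + k) % 4) b (3 * (c + d + k) % 4) d k)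
    (h4 : ∀ a b c d k, T a b c d k = T a k (3 * (a + b + c + d + k) % 4) d b)
    (h0 : ∀ a b c d, T a b c d 0 =
      (jl a b).ev q p P * (jl c d).ev q p P - (jl (a + c) (b + d)).ev q p P) :
    ∑ a ∈ Finset.range 4, ∑ b ∈ Finset.range 4, ∑ c ∈ Finset.range 4, ∑ d ∈ Finset.range 4,
      ∑ k ∈ Finset.range 4, T a b c d k =
    801 - 68 * q - 465 * p - 465 * P + q * q + 15 * (q * p) + 15 * (q * P) + 75 * (p * p) +
      78 * (p * P) + 75 * (P * P) + 30 * T 2 1 2 2 2 + 12 * T 1 1 3 1 3 + T 2 2 2 2 2 +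
      30 * T 3 2 3 2 1 + 10 * T 1 1 1 1 1 + 10 * T 3 3 3 3 3 := by
  set e : Lin → ℂ := fun r => r.ev q p P (T 2 1 2 2 2) (T 1 1 3 1 3) (T 2 2 2 2 2) (T 3 2 3 2 1)
        (T 1 1 1 1 1) (T 3 3 3 3 3) with he_def
  have he : ∀ x y, e (x.add y) = e x + e y := fun x y => Lin.ev_add _ _ _ _ _ _ _ _ _ x y
  have hw := walk_spec T q p P h1 h2 h3 h4 h0 thePath
  have := tot4_spec e he (fun a r ha => tot4_spec e he (fun b r hb => tot4_spec e he
    (fun c r hc => tot4_spec e he (fun d r hd => tot4_spec e he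
      (fun k r hk => hw a b c d k r hk) hd) hc) hb) ha) total_eq
  rw [this]
  simp only [he_def, Lin.ev]
  push_cast
  ring

end PartB


section PartC
variable {F : Type*} [Field F] [Fintype F]

lemma jacobi_inv (A B : MulChar F ℂ) (hA : A (-1) = 1) :
    jacobiSum B A = jacobiSum (A * B)⁻¹ A := by
  unfold jacobiSum
  refine Fintype.sum_equiv (Equiv.inv F) _ _ fun x => ?_
  simp only [Equiv.inv_apply]
  by_cases hx : x = 0
  · simp [hx, MulChar.map_zero]
  rw [show (1 - x⁻¹) = -((1 - x) * x⁻¹) by field_simp; ring, mc_neg hA]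
  simp only [mul_inv, MulChar.mul_apply, map_mul, mc_inv, inv_inv]
  linear_combination -(B x * A (1 - x)) * mc_inv_mul A hx

lemma pow_neg_one {χ : MulChar F ℂ} (h : χ (-1) = 1) (n : ℕ) : (χ ^ n) (-1) = 1 := by
  have := MulChar.pow_apply_coe χ n (-1 : Fˣ)
  simpa [h] using this

lemma mc_pow_mod {χ : MulChar F ℂ} {m : ℕ} (h : χ ^ m = 1) (n : ℕ) : χ ^ (n % m) = χ ^ n := by
  conv_rhs => rw [← Nat.div_add_mod n m, pow_add, pow_mul, h, one_pow, one_mul]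

lemma inv_pow4 {χ : MulChar F ℂ} (h4 : χ ^ 4 = 1) (n : ℕ) : (χ ^ n)⁻¹ = χ ^ (3 * n % 4) := by
  rw [mc_pow_mod h4, inv_eq_iff_mul_eq_one, ← pow_add, show n + 3 * n = 4 * n by ring, pow_mul,
    h4, one_pow]

lemma jacobi_table {χ : MulChar F ℂ} (ho : orderOf χ = 4) (hm : χ (-1) = 1) (a b : ℕ) :
    jacobiSum (χ ^ a) (χ ^ b) = (jl a b).ev (Fintype.card F) (jacobiSum χ (χ ^ 2))
      (jacobiSum (χ ^ 3) (χ ^ 2)) := by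
  have h4 : χ ^ 4 = 1 := ho ▸ pow_orderOf_eq_one χ
  have h1 : χ ≠ 1 := by rintro rfl; simp at ho
  have h2 : χ ^ 2 ≠ 1 := fun h => by
    have := orderOf_dvd_of_pow_eq_one h; rw [ho] at this; revert this; decide
  have h3 : χ ^ 3 ≠ 1 := fun h => by
    have := orderOf_dvd_of_pow_eq_one h; rw [ho] at this; revert this; decide
  have i1 : χ⁻¹ = χ ^ 3 := by simpa using inv_pow4 h4 1
  have i2 : (χ ^ 2)⁻¹ = χ ^ 2 := by simpa using inv_pow4 h4 2
  have i3 : (χ ^ 3)⁻¹ = χ := by simpa using inv_pow4 h4 3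
  have n1 : jacobiSum (χ ^ 1) (χ ^ 3) = -1 := by
    rw [pow_one, ← i1, jacobiSum_nontrivial_inv h1, hm]
  have n2 : jacobiSum (χ ^ 2) (χ ^ 2) = -1 := by
    have := jacobiSum_nontrivial_inv h2
    rwa [i2, pow_neg_one hm] at this
  have n3 : jacobiSum (χ ^ 3) (χ ^ 1) = -1 := by rw [jacobiSum_comm, n1]
  have t1 : jacobiSum 1 (χ ^ 1) = -1 := by rw [pow_one]; exact jacobiSum_one_nontrivial h1
  have t2 : jacobiSum 1 (χ ^ 2) = -1 := jacobiSum_one_nontrivial h2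
  have t3 : jacobiSum 1 (χ ^ 3) = -1 := jacobiSum_one_nontrivial h3
  have t00 : jacobiSum (1 : MulChar F ℂ) 1 = Fintype.card F - 2 := jacobiSum_one_one
  have p11 : jacobiSum (χ ^ 1) (χ ^ 1) = jacobiSum χ (χ ^ 2) := by
    rw [pow_one, jacobi_inv χ χ hm, ← pow_two, i2, jacobiSum_comm]
  have p33 : jacobiSum (χ ^ 3) (χ ^ 3) = jacobiSum (χ ^ 3) (χ ^ 2) := by
    rw [jacobi_inv _ (χ ^ 3) (pow_neg_one hm 3), ← pow_add, inv_pow4 h4, jacobiSum_comm]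
  rw [← mc_pow_mod h4 a, ← mc_pow_mod h4 b]
  unfold jl
  have ha : a % 4 < 4 := Nat.mod_lt _ (by norm_num)
  have hb : b % 4 < 4 := Nat.mod_lt _ (by norm_num)
  generalize a % 4 = a at *
  generalize b % 4 = b at *
  interval_cases a <;> interval_cases b <;>
    simp only [Lin1.ev, pow_zero, n1, n2, n3, t1, t2, t3, t00, p11, p33, jacobiSum_comm _ 1,
      jacobiSum_comm (χ ^ 2) (χ ^ 1), jacobiSum_comm (χ ^ 2) (χ ^ 3)] <;> push_cast <;> (try rw [pow_one]) <;> ring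

/-- the total character sum -/
lemma total_char {χ : MulChar F ℂ} (ho : orderOf χ = 4) (hm : χ (-1) = 1) (q p P : ℂ)
    (hq : q = Fintype.card F) (hp : p = jacobiSum χ (χ ^ 2)) (hP : P = jacobiSum (χ ^ 3) (χ ^ 2)) :
    ∑ a ∈ Finset.range 4, ∑ b ∈ Finset.range 4, ∑ c ∈ Finset.range 4, ∑ d ∈ Finset.range 4,
      ∑ k ∈ Finset.range 4, TT (χ ^ a) (χ ^ b) (χ ^ c) (χ ^ d) (χ ^ k) =
    801 - 68 * q - 465 * p - 465 * P + q * q + 15 * (q * p) + 15 * (q * P) + 75 * (p * p) +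
      78 * (p * P) + 75 * (P * P) + 30 * TT (χ ^ 2) (χ ^ 1) (χ ^ 2) (χ ^ 2) (χ ^ 2)
      + 12 * TT (χ ^ 1) (χ ^ 1) (χ ^ 3) (χ ^ 1) (χ ^ 3)
      + TT (χ ^ 2) (χ ^ 2) (χ ^ 2) (χ ^ 2) (χ ^ 2) +
      30 * TT (χ ^ 3) (χ ^ 2) (χ ^ 3) (χ ^ 2) (χ ^ 1)
      + 10 * TT (χ ^ 1) (χ ^ 1) (χ ^ 1) (χ ^ 1) (χ ^ 1)
      + 10 * TT (χ ^ 3) (χ ^ 3) (χ ^ 3) (χ ^ 3) (χ ^ 3) := by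
  have h4 : χ ^ 4 = 1 := ho ▸ pow_orderOf_eq_one χ
  have hn := pow_neg_one hm
  refine total_spec (fun a b c d k => TT (χ ^ a) (χ ^ b) (χ ^ c) (χ ^ d) (χ ^ k)) q p P
    ?_ ?_ ?_ ?_ ?_
  · intro a b c d k; exact TT_s1 _ _ _ _ _ (hn _)
  · intro a b c d k; exact TT_s2 _ _ _ _ _ (hn _)
  · intro a b c d k
    rw [TT_s3 _ _ _ _ _ (hn _) (hn _) (hn _)]
    simp only [← pow_add, inv_pow4 h4]
  · intro a b c d k
    rw [TT_s4 _ _ _ _ _ (hn _) (hn _) (hn _)]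
    simp only [← pow_add, inv_pow4 h4]
  · intro a b c d
    simp only [pow_zero]
    rw [TT_zero, ← pow_add, ← pow_add, hq, hp, hP, jacobi_table ho hm a b, jacobi_table ho hm c d,
      jacobi_table ho hm (a + c) (b + d)]

lemma pow_apply_ne {χ : MulChar F ℂ} (n : ℕ) {z : F} (hz : z ≠ 0) : (χ ^ n) z = χ z ^ n := by
  have := MulChar.pow_apply_coe χ n (Units.mk0 z hz)
  simpa using this

/-- nonzero fourth powers -/
def IsP4 {R : Type*} [CommRing R] (z : R) : Prop := ∃ w : Rˣ, z = (w : R) ^ 4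

/-- a character of order `n` has value one exactly on the `n`-th powers -/
lemma char_eq_one_iff {χ : MulChar F ℂ} {n : ℕ} (ho : orderOf χ = n) (z : F) :
    χ z = 1 ↔ ∃ w : Fˣ, z = (w : F) ^ n := by
  constructor
  · intro h
    have hz : z ≠ 0 := by rintro rfl; simp [MulChar.map_zero] at h
    obtain ⟨g, hg⟩ := IsCyclic.exists_generator (α := Fˣ)
    obtain ⟨k, hk⟩ := hg (Units.mk0 z hz)
    simp only at hk
    have hg1 : orderOf (χ.toUnitHom g) = n := by
      rw [← ho]
      refine Nat.dvd_antisymm (orderOf_dvd_of_pow_eq_one ?_) (orderOf_dvd_of_pow_eq_one ?_)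
      · ext
        rw [Units.val_pow_eq_pow_val, MulChar.coe_toUnitHom, ← MulChar.pow_apply_coe,
          pow_orderOf_eq_one, MulChar.one_apply_coe, Units.val_one]
      · rw [MulChar.eq_iff hg, MulChar.pow_apply_coe, MulChar.one_apply_coe,
          ← MulChar.coe_toUnitHom, ← Units.val_pow_eq_pow_val, pow_orderOf_eq_one, Units.val_one]
    have h1 : χ.toUnitHom g ^ k = 1 := by
      rw [← map_zpow, hk]; ext; rw [MulChar.coe_toUnitHom]; simpa using h
    obtain ⟨m, rfl⟩ : (n : ℤ) ∣ k := by rw [← hg1]; exact orderOf_dvd_iff_zpow_eq_one.mpr h1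
    refine ⟨g ^ m, ?_⟩
    have : z = ((Units.mk0 z hz : Fˣ) : F) := rfl
    rw [this, ← hk, ← Units.val_pow_eq_pow_val]
    congr 1
    rw [mul_comm, zpow_mul, zpow_natCast]
  · rintro ⟨w, rfl⟩
    rw [map_pow, ← MulChar.pow_apply_coe, ← ho, pow_orderOf_eq_one, MulChar.one_apply_coe]

open Classical in
lemma ind4 {χ : MulChar F ℂ} (ho : orderOf χ = 4) (z : F) :
    ∑ a ∈ Finset.range 4, (χ ^ a) z = 4 * if IsP4 z then 1 else 0 := by
  by_cases hz : z = 0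
  · subst hz
    have : ¬ IsP4 (0 : F) := by
      rintro ⟨w, hw⟩; exact pow_ne_zero 4 w.ne_zero hw.symm
    simp [this, MulChar.map_zero]
  have hiff : IsP4 z ↔ χ z = 1 := (char_eq_one_iff ho z).symm
  rw [hiff]
  have h4 : χ z ^ 4 = 1 := by
    rw [← pow_apply_ne _ hz, ← ho, pow_orderOf_eq_one, MulChar.one_apply (isUnit_iff_ne_zero.mpr hz)]
  simp only [pow_apply_ne _ hz]
  split_ifs with h
  · simp [h]
  · rw [mul_zero]
    have := mul_geom_sum (χ z) 4
    rw [h4, sub_self, mul_eq_zero] at this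
    exact this.resolve_left (sub_ne_zero.mpr h)

open Classical in
/-- number of pairs completing `0, 1` to a clique -/
noncomputable def NN (F : Type*) [Field F] [Fintype F] : ℕ :=
  ∑ x : F, ∑ y : F, if IsP4 x ∧ IsP4 (1 - x) ∧ IsP4 y ∧ IsP4 (1 - y) ∧ IsP4 (x - y) then 1 else 0

lemma sum_TT_eq {χ : MulChar F ℂ} (ho : orderOf χ = 4) :
    ∑ a ∈ Finset.range 4, ∑ b ∈ Finset.range 4, ∑ c ∈ Finset.range 4, ∑ d ∈ Finset.range 4,
      ∑ k ∈ Finset.range 4, TT (χ ^ a) (χ ^ b) (χ ^ c) (χ ^ d) (χ ^ k) = 1024 * (NN F : ℂ) := by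
  classical
  have e : ∀ x y : F, ∑ a ∈ Finset.range 4, ∑ b ∈ Finset.range 4, ∑ c ∈ Finset.range 4,
      ∑ d ∈ Finset.range 4, ∑ k ∈ Finset.range 4,
        (χ ^ a) x * (χ ^ b) (1 - x) * (χ ^ c) y * (χ ^ d) (1 - y) * (χ ^ k) (x - y) =
      (∑ a ∈ Finset.range 4, (χ ^ a) x) * (∑ a ∈ Finset.range 4, (χ ^ a) (1 - x)) *
      (∑ a ∈ Finset.range 4, (χ ^ a) y) * (∑ a ∈ Finset.range 4, (χ ^ a) (1 - y)) *
      (∑ a ∈ Finset.range 4, (χ ^ a) (x - y)) := by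
    intro x y
    simp only [← Finset.mul_sum, ← Finset.sum_mul]
  unfold TT NN
  have sw : ∀ (f : F → F → ℕ → ℂ), ∑ a ∈ Finset.range 4, ∑ x : F, ∑ y : F, f x y a =
      ∑ x : F, ∑ y : F, ∑ a ∈ Finset.range 4, f x y a := by
    intro f
    rw [Finset.sum_comm]
    refine Finset.sum_congr rfl fun x _ => ?_
    rw [Finset.sum_comm]
  simp only [sw, e, ind4 ho]
  push_cast
  rw [Finset.mul_sum]
  refine Finset.sum_congr rfl fun x _ => ?_
  rw [Finset.mul_sum]
  refine Finset.sum_congr rfl fun y _ => ?_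
  simp only [ite_and]
  split_ifs <;> norm_num

end PartC

section PartD
variable {F : Type*} [Field F] [Fintype F]

lemma mc_star_inv (A : MulChar F ℂ) : A.ringHomComp (starRingEnd ℂ) = A⁻¹ := by
  rw [← MulChar.star_eq_inv]; rfl

open Classical in
lemma orthog [Fintype (MulChar F ℂ)] (z : F) :
    ∑ χ : MulChar F ℂ, χ z = if z = 1 then (Fintype.card F : ℂ) - 1 else 0 := by
  split_ifs with h
  · subst h
    have := MulChar.card_eq_card_units_of_hasEnoughRootsOfUnity F ℂ
    rw [Nat.card_eq_fintype_card, Nat.card_eq_fintype_card, Fintype.card_units] at this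
    simp [this, Nat.cast_sub Fintype.card_pos]
  · obtain ⟨χ, hχ⟩ := MulChar.exists_apply_ne_one_of_hasEnoughRootsOfUnity F ℂ h
    have h2 : χ z * ∑ ψ : MulChar F ℂ, ψ z = ∑ ψ : MulChar F ℂ, ψ z := by
      rw [Finset.mul_sum]
      exact Fintype.sum_equiv (Equiv.mulLeft χ) _ _ fun ψ => by simp
    have h3 : (χ z - 1) * ∑ ψ : MulChar F ℂ, ψ z = 0 := by rw [sub_mul, h2]; ring
    exact (mul_eq_zero.1 h3).resolve_left (sub_ne_zero.2 hχ)

open Classical in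
lemma binom_eq (A χ : MulChar F ℂ) (hA : A (-1) = 1) :
    (Fintype.card F : ℂ) * charBinom (A * χ) χ = jacobiSum χ A := by
  have hq : (Fintype.card F : ℂ) ≠ 0 := by exact_mod_cast Fintype.card_ne_zero
  unfold charBinom
  rw [mc_star_inv, ← mul_assoc, mul_div_cancel₀ _ hq]
  unfold jacobiSum
  rw [Finset.mul_sum]
  have hinv : Function.Involutive (fun x : F => if x = 1 then (1 : F) else x / (x - 1)) := by
    intro x
    by_cases h : x = 1
    · simp [h]
    · have h1 : x - 1 ≠ 0 := sub_ne_zero.2 h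
      have h2 : x / (x - 1) ≠ 1 := by
        intro h3; rw [div_eq_one_iff_eq h1] at h3
        have : (1 : F) = 0 := by linear_combination h3
        exact one_ne_zero this
      simp only [h, if_false, h2]
      field_simp
      ring
  refine Fintype.sum_equiv hinv.toPerm _ _ fun x => ?_
  simp only [Function.Involutive.coe_toPerm]
  by_cases h : x = 1
  · simp [h, MulChar.map_zero]
  · have h1 : x - 1 ≠ 0 := sub_ne_zero.2 h
    have h0 : 1 - x ≠ 0 := sub_ne_zero.2 (Ne.symm h)
    simp only [h, if_false]
    rw [show 1 - x / (x - 1) = (1 - x)⁻¹ by field_simp; ring,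
      show x / (x - 1) = (-1) * x * (1 - x)⁻¹ by field_simp; ring]
    rw [map_mul, map_mul, ← mc_inv, MulChar.mul_apply, MulChar.mul_apply, hA]
    ring

open Classical in
lemma hyp_eq (A B C : MulChar F ℂ) (hA : A (-1) = 1) (hB : B (-1) = 1) (hC : C (-1) = 1) :
    (Fintype.card F : ℂ) ^ 2 * hyp3F2 A B C 1 1 = TT C⁻¹ A B⁻¹ B C := by
  have hq : (Fintype.card F : ℂ) ≠ 0 := by exact_mod_cast Fintype.card_ne_zero
  have hq1 : (Fintype.card F : ℂ) - 1 ≠ 0 := by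
    rw [sub_ne_zero]; exact_mod_cast Fintype.one_lt_card.ne'
  haveI : Fintype (MulChar F ℂ) := Fintype.ofFinite _
  unfold hyp3F2
  rw [finsum_eq_sum_of_fintype]
  simp only [one_mul, map_one, mul_one]
  have key : (Fintype.card F : ℂ) ^ 3 * ∑ χ : MulChar F ℂ,
      charBinom (A * χ) χ * charBinom (B * χ) χ * charBinom (C * χ) χ =
      ((Fintype.card F : ℂ) - 1) * TT C⁻¹ A B⁻¹ B C := by
    rw [Finset.mul_sum]
    have e1 : ∀ χ : MulChar F ℂ, (Fintype.card F : ℂ) ^ 3 *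
        (charBinom (A * χ) χ * charBinom (B * χ) χ * charBinom (C * χ) χ) =
        ∑ x : F, ∑ y : F, ∑ z : F, A (1 - x) * B (1 - y) * C (1 - z) * χ (x * y * z) := by
      intro χ
      calc _ = ((Fintype.card F : ℂ) * charBinom (A * χ) χ) *
            ((Fintype.card F : ℂ) * charBinom (B * χ) χ) *
            ((Fintype.card F : ℂ) * charBinom (C * χ) χ) := by ring
        _ = jacobiSum χ A * jacobiSum χ B * jacobiSum χ C := by
            rw [binom_eq _ _ hA, binom_eq _ _ hB, binom_eq _ _ hC]
        _ = _ := by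
            unfold jacobiSum
            rw [Finset.sum_mul_sum, Finset.sum_mul]
            refine Finset.sum_congr rfl fun x _ => ?_
            rw [Finset.sum_mul]
            refine Finset.sum_congr rfl fun y _ => ?_
            rw [Finset.mul_sum]
            refine Finset.sum_congr rfl fun z _ => ?_
            rw [map_mul, map_mul]; ring
    rw [Finset.sum_congr rfl fun χ _ => e1 χ, Finset.sum_comm]
    unfold TT
    rw [Finset.mul_sum]
    refine Finset.sum_congr rfl fun x _ => ?_
    rw [Finset.sum_comm, Finset.mul_sum]
    by_cases hx : x = 0
    · subst hx
      simp [MulChar.map_zero]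
    refine Fintype.sum_equiv (Equiv.inv F) _ _ fun y => ?_
    rw [Finset.sum_comm]
    by_cases hy : y = 0
    · subst hy
      simp [MulChar.map_zero]
    simp only [← Finset.mul_sum, orthog, Equiv.inv_apply]
    rw [Finset.sum_eq_single (x * y)⁻¹]
    · rw [if_pos (by field_simp)]
      have : C (1 - (x * y)⁻¹) = C⁻¹ x * C (x - y⁻¹) := by
        rw [← mc_inv, ← map_mul]; congr 1; field_simp
      have h2 : B (1 - y) = B⁻¹ y⁻¹ * B (1 - y⁻¹) := by
        rw [← mc_inv, ← map_mul, mc_sub hB]; congr 1; field_simp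
      rw [this, h2]; ring
    · intro z _ hz
      rw [if_neg, mul_zero]
      intro h; apply hz
      rw [eq_comm, inv_eq_of_mul_eq_one_right h]
    · simp
  field_simp
  linear_combination key

end PartD

section PartE
variable {F : Type*} [Field F] [Fintype F]

lemma ml_apply {a : F} (h : a ≠ 0) (x : F) : Equiv.mulLeft₀ a h x = a * x := rfl

lemma mr_apply {a : F} (h : a ≠ 0) (x : F) : Equiv.mulRight₀ a h x = x * a := rfl

lemma sum_mc {A : MulChar F ℂ} (hA : A ≠ 1) : ∑ x : F, A x = 0 :=
  MulChar.sum_eq_zero_of_ne_one hA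

lemma gauss_transform {C : MulChar F ℂ} (hC : C ≠ 1) (ψ : AddChar F ℂ) (d : F) :
    C d * gaussSum C⁻¹ ψ = ∑ s : F, C⁻¹ s * ψ (s * d) := by
  by_cases hd : d = 0
  · subst hd
    simp [MulChar.map_zero, sum_mc (inv_ne_one.2 hC)]
  · unfold gaussSum
    rw [Finset.mul_sum]
    refine (Fintype.sum_equiv (Equiv.mulRight₀ d hd) _ _ fun s => ?_).symm
    simp only [mr_apply, map_mul]
    have := mc_inv_mul C hd
    linear_combination (-C⁻¹ s * ψ (s * d)) * this

lemma gauss_shift (C : MulChar F ℂ) (ψ : AddChar F ℂ) {σ : F} (hσ : σ ≠ 0) :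
    ∑ r : F, C r * ψ (σ * r) = C⁻¹ σ * gaussSum C ψ := by
  have := gaussSum_mulShift_eq C ψ (Units.mk0 σ hσ)
  simpa [gaussSum, AddChar.mulShift_apply] using this

lemma quad_values {φ : MulChar F ℂ} (hφ : orderOf φ = 2) (x : F) [DecidableEq F] :
    φ x = (quadraticChar F x : ℂ) := by
  by_cases hx : x = 0
  · simp [hx, MulChar.map_zero]
  have h2 : φ x ^ 2 = 1 := by
    rw [← pow_apply_ne 2 hx, ← hφ, pow_orderOf_eq_one, MulChar.one_apply (isUnit_iff_ne_zero.2 hx)]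
  have hs : φ x = 1 ↔ IsSquare x := by
    rw [char_eq_one_iff hφ]
    constructor
    · rintro ⟨w, rfl⟩; exact ⟨w, sq _⟩
    · rintro ⟨w, rfl⟩
      have : w ≠ 0 := by rintro rfl; simp at hx
      exact ⟨Units.mk0 w this, by simp [sq]⟩
  by_cases hsq : IsSquare x
  · rw [hs.2 hsq, (quadraticChar_one_iff_isSquare hx).2 hsq]; simp
  · have h1 : φ x = -1 := by
      rcases (sq_eq_one_iff.1 h2) with h | h
      · exact absurd (hs.1 h) hsq
      · exact h
    rw [h1, quadraticChar_neg_one_iff_not_isSquare.2 hsq]; simp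

open Classical in
lemma sum_sq {φ : MulChar F ℂ} (hφ : orderOf φ = 2) (hF : ringChar F ≠ 2) (f : F → ℂ) :
    ∑ b : F, f (b ^ 2) = ∑ z : F, (1 + φ z) * f z := by
  rw [← Finset.sum_fiberwise (s := Finset.univ) (g := fun b : F => b ^ 2)]
  refine Finset.sum_congr rfl fun z _ => ?_
  rw [Finset.sum_congr rfl (g := fun _ => f z) (by
    intro b hb; rw [(Finset.mem_filter.1 hb).2]), Finset.sum_const, nsmul_eq_mul]
  congr 1
  have := quadraticChar_card_sqrts hF z
  rw [quad_values hφ, add_comm]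
  have h2 : ((Finset.univ.filter fun b : F => b ^ 2 = z).card : ℤ) = quadraticChar F z + 1 := by
    rw [← this]; congr 2; ext; simp
  exact_mod_cast congrArg (Int.cast : ℤ → ℂ) h2

lemma two_ne (hF : ringChar F ≠ 2) : (2 : F) ≠ 0 := Ring.two_ne_zero hF

lemma quad_gauss {φ : MulChar F ℂ} (hφ : orderOf φ = 2) (hF : ringChar F ≠ 2)
    {ψ : AddChar F ℂ} (hψ : ψ.IsPrimitive) {s : F} (hs : s ≠ 0) (t : F) :
    ∑ b : F, ψ (s * b ^ 2 + t * b) = φ s * gaussSum φ ψ * ψ (-t ^ 2 / (4 * s)) := by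
  have h2 := two_ne hF
  have h4 : (4 : F) ≠ 0 := by
    rw [show (4 : F) = 2 * 2 by norm_num]; exact mul_ne_zero h2 h2
  have e1 : ∑ b : F, ψ (s * b ^ 2 + t * b) =
      ∑ b : F, ψ (s * b ^ 2) * ψ (-t ^ 2 / (4 * s)) := by
    refine Fintype.sum_equiv (Equiv.addRight (t / (2 * s))) _ _ fun b => ?_
    rw [← AddChar.map_add_eq_mul]; congr 1
    simp only [Equiv.coe_addRight]
    field_simp; ring
  rw [e1, ← Finset.sum_mul, sum_sq hφ hF (fun z => ψ (s * z))]
  congr 1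
  simp only [add_mul, one_mul, Finset.sum_add_distrib]
  classical
  have h0 : ∑ x : F, ψ (s * x) = 0 := by
    have := AddChar.sum_mulShift s hψ
    simp only [mul_comm s]
    rw [this, if_neg hs]; simp
  rw [h0, zero_add, gauss_shift φ ψ hs]
  have : φ⁻¹ = φ := by
    rw [inv_eq_iff_mul_eq_one, ← sq, ← hφ, pow_orderOf_eq_one]
  rw [this]

lemma ker_sum {φ : MulChar F ℂ} (hφ : orderOf φ = 2) (hF : ringChar F ≠ 2)
    {ψ : AddChar F ℂ} (hψ : ψ.IsPrimitive) {s : F} (hs : s ≠ 0) (t1 t2 t3 : F) :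
    ∑ a : F, ∑ b : F, ∑ c : F,
      ψ (t1 * a + t2 * c + t3 * (a + b + c) + s * (b ^ 2 - 4 * a * c)) =
    (Fintype.card F : ℂ) * gaussSum φ ψ * (φ s * ψ ((t1 * t2 + t1 * t3 + t2 * t3) / (4 * s))) := by
  classical
  have h2 := two_ne hF
  have h4 : (4 : F) ≠ 0 := by
    rw [show (4 : F) = 2 * 2 by norm_num]; exact mul_ne_zero h2 h2
  have e1 : ∀ a b c : F, ψ (t1 * a + t2 * c + t3 * (a + b + c) + s * (b ^ 2 - 4 * a * c)) =
      ψ (s * b ^ 2 + t3 * b) * (ψ ((t2 + t3) * c) * ψ (a * ((t1 + t3) - 4 * s * c))) := by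
    intro a b c
    rw [← AddChar.map_add_eq_mul, ← AddChar.map_add_eq_mul]; congr 1; ring
  simp only [e1]
  rw [Finset.sum_comm]
  simp only [← Finset.mul_sum]
  rw [← Finset.sum_mul, quad_gauss hφ hF hψ hs, Finset.sum_comm]
  simp only [← Finset.mul_sum, AddChar.sum_mulShift _ hψ]
  rw [Finset.sum_eq_single ((t1 + t3) / (4 * s))]
  · rw [if_pos (by field_simp; ring)]
    have : ψ (-t3 ^ 2 / (4 * s)) * ψ ((t2 + t3) * ((t1 + t3) / (4 * s))) =
        ψ ((t1 * t2 + t1 * t3 + t2 * t3) / (4 * s)) := by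
      rw [← AddChar.map_add_eq_mul]; congr 1; field_simp; ring
    rw [← this]; ring
  · intro c _ hc
    rw [if_neg]; · simp
    intro h; apply hc; field_simp; linear_combination -h
  · simp

lemma prod4 (f g h k : F → ℂ) : (∑ x, f x) * (∑ x, g x) * (∑ x, h x) * (∑ x, k x) =
    ∑ t : F × F × F × F, f t.1 * g t.2.1 * h t.2.2.1 * k t.2.2.2 := by
  simp only [Fintype.sum_prod_type, ← Finset.mul_sum, ← Finset.sum_mul]

noncomputable def WW (A B C : MulChar F ℂ) : ℂ :=
  ∑ s : F, ∑ p : F, A p * B (1 - s + p) * C (s ^ 2 - 4 * p)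

lemma V_eq (A B C E : MulChar F ℂ) (hE : E * A * B * C ^ 2 = 1) :
    ∑ a : F, ∑ b : F, ∑ c : F, E a * A c * B (a + b + c) * C (b ^ 2 - 4 * a * c) =
    ((Fintype.card F : ℂ) - 1) * WW A B C := by
  classical
  have e1 : ∀ a : F, ∑ b : F, ∑ c : F, E a * A c * B (a + b + c) * C (b ^ 2 - 4 * a * c) =
      if a = 0 then 0 else WW A B C := by
    intro a
    split_ifs with ha
    · subst ha; simp [MulChar.map_zero]
    · unfold WW
      refine (Fintype.sum_equiv (Equiv.mulLeft₀ (-a) (neg_ne_zero.2 ha)) _ _ fun b => ?_).symm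
      refine (Fintype.sum_equiv (Equiv.mulLeft₀ a ha) _ _ fun c => ?_)
      simp only [ml_apply]
      rw [show a + -a * b + a * c = a * (1 - b + c) by ring,
        show (-a * b) ^ 2 - 4 * a * (a * c) = a ^ 2 * (b ^ 2 - 4 * c) by ring]
      simp only [map_mul]
      have h1 : E a * A a * B a * C (a ^ 2) = 1 := by
        have := congrArg (fun χ : MulChar F ℂ => χ a) hE
        simpa [MulChar.mul_apply, MulChar.one_apply (isUnit_iff_ne_zero.2 ha), pow_apply_ne 2 ha]
          using this
      linear_combination (-(A c * B (1 - b + c) * C (b ^ 2 - 4 * c))) * h1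
  rw [Finset.sum_congr rfl fun a _ => e1 a, Finset.sum_ite]
  simp only [Finset.sum_const_zero, zero_add, Finset.sum_const, nsmul_eq_mul]
  congr 1
  rw [Finset.filter_ne' Finset.univ (0 : F), Finset.card_erase_of_mem (Finset.mem_univ _),
    Finset.card_univ, Nat.cast_sub (Nat.succ_le_of_lt Fintype.card_pos)]
  simp

lemma selberg_aux {φ : MulChar F ℂ} (hφ : orderOf φ = 2) (hF : ringChar F ≠ 2)
    {ψ : AddChar F ℂ} (A B C E : MulChar F ℂ) (hE : E * A * B * C ^ 2 = 1) :
    ∑ t : F × F × F × F, E⁻¹ t.1 * A⁻¹ t.2.1 * B⁻¹ t.2.2.1 * (C⁻¹ t.2.2.2 * (φ t.2.2.2 *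
      ψ ((t.1 * t.2.1 + t.1 * t.2.2.1 + t.2.1 * t.2.2.1) / (4 * t.2.2.2)))) =
    ((Fintype.card F : ℂ) - 1) * C 4 *
      (gaussSum (A * C * φ) ψ * gaussSum (B * C * φ) ψ * gaussSum (E * C * φ) ψ) := by
  classical
  have h2 := two_ne hF
  have h4 : (4 : F) ≠ 0 := by
    rw [show (4 : F) = 2 * 2 by norm_num]; exact mul_ne_zero h2 h2
  have hφ2 : φ * φ = 1 := by rw [← sq, ← hφ, pow_orderOf_eq_one]
  have hφx : ∀ x : F, x ≠ 0 → φ x * φ x = 1 := fun x hx => by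
    have := congrArg (fun χ : MulChar F ℂ => χ x) hφ2
    simpa [MulChar.mul_apply, MulChar.one_apply (isUnit_iff_ne_zero.2 hx)] using this
  have hφi : φ⁻¹ = φ := by rw [inv_eq_iff_mul_eq_one, hφ2]
  have hφ4 : φ 4 = 1 := by
    rw [show (4 : F) = 2 * 2 by norm_num, map_mul, hφx 2 h2]
  calc _ = ∑ r1 : F, ∑ r2 : F, ∑ r3 : F, ∑ σ : F,
        (C (4 * σ) * φ (4 * σ)) * (((E * C * φ) r1 * ψ (σ * r1)) * ((A * C * φ) r2 * ψ (σ * r2)) *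
          ((B * C * φ) r3 * ψ (σ * r3))) := by
        simp only [Fintype.sum_prod_type]
        refine Fintype.sum_equiv (Equiv.inv F) _ _ fun r1 => ?_
        by_cases h1 : r1 = 0
        · subst h1; simp [MulChar.map_zero]
        refine Fintype.sum_equiv (Equiv.inv F) _ _ fun r2 => ?_
        by_cases h2 : r2 = 0
        · subst h2; simp [MulChar.map_zero]
        refine Fintype.sum_equiv (Equiv.inv F) _ _ fun r3 => ?_
        by_cases h3 : r3 = 0
        · subst h3; simp [MulChar.map_zero]
        have hne : r1 * r2 * r3 / 4 ≠ 0 := by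
          exact div_ne_zero (mul_ne_zero (mul_ne_zero h1 h2) h3) h4
        refine Fintype.sum_equiv ((Equiv.inv F).trans (Equiv.mulLeft₀ _ hne)) _ _ fun s => ?_
        simp only [Equiv.trans_apply, Equiv.inv_apply, ml_apply]
        by_cases hs : s = 0
        · subst hs; simp [MulChar.map_zero]
        have e1 : ψ ((r1 * r2 + r1 * r3 + r2 * r3) / (4 * s)) =
            ψ (r1 * r2 * r3 / 4 * s⁻¹ * r1⁻¹) * ψ (r1 * r2 * r3 / 4 * s⁻¹ * r2⁻¹) *
            ψ (r1 * r2 * r3 / 4 * s⁻¹ * r3⁻¹) := by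
          rw [← AddChar.map_add_eq_mul, ← AddChar.map_add_eq_mul]; congr 1
          field_simp; ring
        rw [e1, show 4 * (r1 * r2 * r3 / 4 * s⁻¹) = r1 * r2 * r3 * s⁻¹ by field_simp]
        simp only [MulChar.mul_apply, map_mul, mc_inv, hφi]
        have c1 := mc_inv_mul C h1
        have c2 := mc_inv_mul C h2
        have c3 := mc_inv_mul C h3
        have d1 := hφx _ h1
        have d2 := hφx _ h2
        have d3 := hφx _ h3
        have : (C⁻¹ r1 * C r1) * (C⁻¹ r2 * C r2) * (C⁻¹ r3 * C r3) *
            ((φ r1 * φ r1) * (φ r2 * φ r2) * (φ r3 * φ r3)) = 1 := by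
          rw [c1, c2, c3, d1, d2, d3]; norm_num
        generalize ψ (r1 * r2 * r3 / 4 * s⁻¹ * r1⁻¹) = x1
        generalize ψ (r1 * r2 * r3 / 4 * s⁻¹ * r2⁻¹) = x2
        generalize ψ (r1 * r2 * r3 / 4 * s⁻¹ * r3⁻¹) = x3
        linear_combination (-(E⁻¹ r1 * A⁻¹ r2 * B⁻¹ r3 * C⁻¹ s * φ s * x1 * x2 * x3)) * this
    _ = ∑ σ : F, if σ = 0 then 0 else C 4 *
      (gaussSum (A * C * φ) ψ * gaussSum (B * C * φ) ψ * gaussSum (E * C * φ) ψ) := by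
        have sw : ∀ f : F → F → F → F → ℂ, ∑ r1 : F, ∑ r2 : F, ∑ r3 : F, ∑ σ : F, f r1 r2 r3 σ =
            ∑ σ : F, ∑ r1 : F, ∑ r2 : F, ∑ r3 : F, f r1 r2 r3 σ := by
          intro f
          have : ∀ r1 : F, ∑ r2 : F, ∑ r3 : F, ∑ σ : F, f r1 r2 r3 σ =
            ∑ σ : F, ∑ r2 : F, ∑ r3 : F, f r1 r2 r3 σ := by
              intro r1
              rw [Finset.sum_congr rfl fun r2 _ => Finset.sum_comm, Finset.sum_comm]
          rw [Finset.sum_congr rfl fun r2 _ => this r2, Finset.sum_comm]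
        rw [sw]
        refine Finset.sum_congr rfl fun σ _ => ?_
        simp only [← Finset.mul_sum, ← Finset.sum_mul]
        split_ifs with hσ
        · simp [hσ, MulChar.map_zero]
        · rw [gauss_shift _ _ hσ, gauss_shift _ _ hσ, gauss_shift _ _ hσ]
          have hc : (C * φ * ((E * C * φ)⁻¹ * (A * C * φ)⁻¹ * (B * C * φ)⁻¹)) = 1 := by
            have : (E * C * φ)⁻¹ * (A * C * φ)⁻¹ * (B * C * φ)⁻¹ = (C * φ)⁻¹ := by
              rw [← mul_inv, ← mul_inv, inv_inj]
              calc _ = (E * A * B * C ^ 2) * (φ * φ) * (C * φ) := by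
                    rw [sq]; ac_rfl
                _ = _ := by rw [hE, hφ2]; simp
            rw [this, mul_inv_cancel]
          have := congrArg (fun χ : MulChar F ℂ => χ σ) hc
          simp only [MulChar.mul_apply, MulChar.one_apply (isUnit_iff_ne_zero.2 hσ)] at this
          rw [map_mul, map_mul, hφ4]
          linear_combination (C 4 *
      (gaussSum (A * C * φ) ψ * gaussSum (B * C * φ) ψ * gaussSum (E * C * φ) ψ)) * this
    _ = _ := by
        rw [Finset.sum_ite]
        simp only [Finset.sum_const_zero, zero_add, Finset.sum_const, nsmul_eq_mul]
        rw [Finset.filter_ne' Finset.univ (0 : F), Finset.card_erase_of_mem (Finset.mem_univ _),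
          Finset.card_univ, Nat.cast_sub (Nat.succ_le_of_lt Fintype.card_pos)]
        push_cast; ring

lemma selberg {φ : MulChar F ℂ} (hφ : orderOf φ = 2) (hF : ringChar F ≠ 2)
    {ψ : AddChar F ℂ} (hψ : ψ.IsPrimitive) (A B C E : MulChar F ℂ) (hE : E * A * B * C ^ 2 = 1)
    (hA1 : A ≠ 1) (hB1 : B ≠ 1) (hC1 : C ≠ 1) (hE1 : E ≠ 1) :
    WW A B C * (gaussSum E⁻¹ ψ * gaussSum A⁻¹ ψ * gaussSum B⁻¹ ψ * gaussSum C⁻¹ ψ) =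
    (Fintype.card F : ℂ) * gaussSum φ ψ * C 4 *
      (gaussSum (A * C * φ) ψ * gaussSum (B * C * φ) ψ * gaussSum (E * C * φ) ψ) := by
  have hq1 : (Fintype.card F : ℂ) - 1 ≠ 0 := by
    rw [sub_ne_zero]; exact_mod_cast Fintype.one_lt_card.ne'
  apply mul_left_cancel₀ hq1
  rw [← mul_assoc, ← V_eq A B C E hE]
  calc _ = ∑ m : F × F × F, ∑ t : F × F × F × F,
        E⁻¹ t.1 * A⁻¹ t.2.1 * B⁻¹ t.2.2.1 * (C⁻¹ t.2.2.2 *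
        ψ (t.1 * m.1 + t.2.1 * m.2.2 + t.2.2.1 * (m.1 + m.2.1 + m.2.2) +
          t.2.2.2 * (m.2.1 ^ 2 - 4 * m.1 * m.2.2))) := by
        rw [Fintype.sum_prod_type, Finset.sum_mul]
        refine Finset.sum_congr rfl fun a _ => ?_
        rw [Fintype.sum_prod_type, Finset.sum_mul]
        refine Finset.sum_congr rfl fun b _ => ?_
        rw [Finset.sum_mul]
        refine Finset.sum_congr rfl fun c _ => ?_
        calc _ = (E a * gaussSum E⁻¹ ψ) * (A c * gaussSum A⁻¹ ψ) *
              (B (a + b + c) * gaussSum B⁻¹ ψ) * (C (b ^ 2 - 4 * a * c) * gaussSum C⁻¹ ψ) := by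
                ring
          _ = _ := by
            rw [gauss_transform hE1, gauss_transform hA1, gauss_transform hB1,
              gauss_transform hC1, prod4]
            refine Finset.sum_congr rfl fun t _ => ?_
            simp only [AddChar.map_add_eq_mul]; ring
    _ = (Fintype.card F : ℂ) * gaussSum φ ψ *
        ∑ t : F × F × F × F, E⁻¹ t.1 * A⁻¹ t.2.1 * B⁻¹ t.2.2.1 * (C⁻¹ t.2.2.2 * (φ t.2.2.2 *
      ψ ((t.1 * t.2.1 + t.1 * t.2.2.1 + t.2.1 * t.2.2.1) / (4 * t.2.2.2)))) := by
        rw [Finset.sum_comm, Finset.mul_sum]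
        refine Finset.sum_congr rfl fun t _ => ?_
        simp only [← Finset.mul_sum]
        by_cases hs : t.2.2.2 = 0
        · simp [hs, MulChar.map_zero]
        · have := ker_sum hφ hF hψ hs t.1 t.2.1 t.2.2.1
          simp only [Fintype.sum_prod_type]
          rw [this]; ring
    _ = _ := by
        rw [selberg_aux hφ hF A B C E hE]; ring

lemma TT_sym {φ : MulChar F ℂ} (hφ : orderOf φ = 2) (hF : ringChar F ≠ 2)
    (A B D : MulChar F ℂ) : TT A B A B (D ^ 2) = WW A B D + WW A B (D * φ) := by
  have h2 := two_ne hF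
  have h4 : (4 : F) ≠ 0 := by
    rw [show (4 : F) = 2 * 2 by norm_num]; exact mul_ne_zero h2 h2
  have hD : ∀ z : F, (D ^ 2) z = D (z ^ 2) := by
    intro z; rw [sq, MulChar.mul_apply, sq, map_mul]
  unfold TT WW
  simp only [hD]
  calc _ = ∑ x : F, ∑ d : F, (A ((x + (x - d)) ^ 2 / 4 - d ^ 2 / 4) *
            B (1 - (x + (x - d)) + ((x + (x - d)) ^ 2 / 4 - d ^ 2 / 4)) * D (d ^ 2)) := by
        refine Finset.sum_congr rfl fun x _ => ?_
        refine Fintype.sum_equiv (Equiv.subLeft x) _ _ fun y => ?_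
        simp only [Equiv.subLeft_apply]
        have e1 : (x + (x - (x - y))) ^ 2 / 4 - (x - y) ^ 2 / 4 = x * y := by
          field_simp; ring
        rw [e1, show 1 - (x + (x - (x - y))) + x * y = (1 - x) * (1 - y) by ring]
        simp only [map_mul]; ring
    _ = ∑ s : F, ∑ d : F, A (s ^ 2 / 4 - d ^ 2 / 4) *
            B (1 - s + (s ^ 2 / 4 - d ^ 2 / 4)) * D (d ^ 2) := by
        rw [Finset.sum_comm]
        rw [Finset.sum_comm (s := Finset.univ (α := F)) (f := fun s d => A (s ^ 2 / 4 - d ^ 2 / 4) *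
            B (1 - s + (s ^ 2 / 4 - d ^ 2 / 4)) * D (d ^ 2))]
        refine Finset.sum_congr rfl fun d _ => ?_
        refine Fintype.sum_equiv ((Equiv.mulLeft₀ 2 h2).trans (Equiv.subRight d)) _ _ fun x => ?_
        simp only [Equiv.trans_apply, ml_apply, Equiv.subRight_apply]
        rw [show x + (x - d) = 2 * x - d by ring]
    _ = _ := by
        rw [← Finset.sum_add_distrib]
        refine Finset.sum_congr rfl fun s _ => ?_
        rw [sum_sq hφ hF (fun z => A (s ^ 2 / 4 - z / 4) *
            B (1 - s + (s ^ 2 / 4 - z / 4)) * D z), ← Finset.sum_add_distrib]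
        refine Fintype.sum_equiv ((Equiv.subLeft (s ^ 2)).trans (Equiv.divRight₀ 4 h4)) _ _
          fun z => ?_
        simp only [Equiv.trans_apply, Equiv.subLeft_apply, Equiv.divRight₀_apply]
        rw [show s ^ 2 - 4 * ((s ^ 2 - z) / 4) = z by field_simp; ring, sub_div,
          MulChar.mul_apply]
        ring

end PartE

section PartE2
variable {F : Type*} [Field F] [Fintype F]

lemma exists_primitive (F : Type*) [Field F] [Fintype F] : ∃ ψ : AddChar F ℂ, ψ.IsPrimitive := by
  obtain ⟨ψ, h⟩ := (AddChar.exists_apply_ne_zero (α := F) (a := 1)).2 one_ne_zero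
  refine ⟨ψ, AddChar.IsPrimitive.of_ne_one ?_⟩
  rintro rfl
  simp at h

lemma card_ne : (Fintype.card F : ℂ) ≠ 0 := by exact_mod_cast Fintype.card_ne_zero

lemma gauss_ne {C : MulChar F ℂ} (hC : C ≠ 1) {ψ : AddChar F ℂ} (hψ : ψ.IsPrimitive) :
    gaussSum C ψ ≠ 0 := gaussSum_ne_zero_of_nontrivial card_ne hC hψ

lemma gauss_prod {C C' : MulChar F ℂ} (hC : C ≠ 1) (h : C * C' = 1)
    {ψ : AddChar F ℂ} (hψ : ψ.IsPrimitive) :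
    gaussSum C ψ * gaussSum C' ψ = C (-1) * Fintype.card F := by
  have h' : C' = C⁻¹ := (inv_eq_of_mul_eq_one_right h).symm
  subst h'
  rw [← mul_gaussSum_inv_eq_gaussSum C⁻¹, mul_left_comm, gaussSum_mul_gaussSum_eq_card hC hψ,
    MulChar.inv_apply', inv_neg_one]

lemma HD_jacobi {φ : MulChar F ℂ} (hφ : orderOf φ = 2) (hF : ringChar F ≠ 2)
    {C : MulChar F ℂ} (hC : C ≠ 1) : C 4 * jacobiSum C C = jacobiSum φ C := by
  have h2 := two_ne hF
  unfold jacobiSum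
  rw [Finset.mul_sum]
  calc _ = ∑ y : F, C (1 - y ^ 2) := by
        refine Fintype.sum_equiv ((Equiv.mulLeft₀ 2 h2).trans (Equiv.subRight 1)) _ _ fun x => ?_
        simp only [Equiv.trans_apply, ml_apply, Equiv.subRight_apply]
        rw [← map_mul, ← map_mul]; congr 1; ring
    _ = _ := by
        rw [sum_sq hφ hF (fun z => C (1 - z))]
        simp only [add_mul, one_mul, Finset.sum_add_distrib]
        have : ∑ z : F, C (1 - z) = 0 := by
          rw [← sum_mc hC]
          exact Fintype.sum_equiv (Equiv.subLeft 1) _ _ fun z => by simp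
        rw [this, zero_add]

lemma HD {φ : MulChar F ℂ} (hφ : orderOf φ = 2) (hF : ringChar F ≠ 2)
    {ψ : AddChar F ℂ} (hψ : ψ.IsPrimitive) {C : MulChar F ℂ} (hC : C * C ≠ 1) :
    C 4 * gaussSum C ψ * gaussSum (C * φ) ψ = gaussSum (C * C) ψ * gaussSum φ ψ := by
  have hC1 : C ≠ 1 := by rintro rfl; simp at hC
  have hφ2 : φ * φ = 1 := by rw [← sq, ← hφ, pow_orderOf_eq_one]
  have hCφ : C * φ ≠ 1 := by
    intro h
    have : C = φ := by
      calc C = C * (φ * φ) := by rw [hφ2, mul_one]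
        _ = (C * φ) * φ := by rw [mul_assoc]
        _ = φ := by rw [h, one_mul]
    exact hC (by rw [this, hφ2])
  have h1 := jacobiSum_mul_nontrivial hC ψ
  have h2 := jacobiSum_mul_nontrivial hCφ ψ
  rw [jacobiSum_comm, ← HD_jacobi hφ hF hC1] at h2
  have h3 := gauss_ne hC1 hψ
  apply mul_left_cancel₀ h3
  linear_combination gaussSum (C * C) ψ * h2 - (C 4 * gaussSum (C * φ) ψ) * h1

lemma pw8 {ω : MulChar F ℂ} (ho : orderOf ω = 8) {a b : ℕ} (h : a % 8 = b % 8) :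
    ω ^ a = ω ^ b := by
  have h8 : ω ^ 8 = 1 := by rw [← ho]; exact pow_orderOf_eq_one ω
  rw [← mc_pow_mod h8 a, ← mc_pow_mod h8 b, h]

lemma pw8_inv {ω : MulChar F ℂ} (ho : orderOf ω = 8) {a b : ℕ} (h : (a + b) % 8 = 0) :
    (ω ^ a)⁻¹ = ω ^ b := by
  apply inv_eq_of_mul_eq_one_right
  rw [← pow_add, ← pow_zero ω]; exact pw8 ho h

lemma pw8_ne {ω : MulChar F ℂ} (ho : orderOf ω = 8) {a : ℕ} (h : a % 8 ≠ 0) : ω ^ a ≠ 1 := by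
  rw [Ne, ← orderOf_dvd_iff_pow_eq_one, ho]
  omega

lemma ord4 {ω : MulChar F ℂ} (ho : orderOf ω = 8) : orderOf (ω ^ 4) = 2 := by
  rw [orderOf_pow, ho]; norm_num

/-- the facts on Gauss sums of the powers of an octic character -/
lemma octic {ω : MulChar F ℂ} (ho : orderOf ω = 8) (hF : ringChar F ≠ 2)
    (h4 : (ω ^ 2) 4 = 1) (hm : (ω ^ 2) (-1) = 1) {ψ : AddChar F ℂ} (hψ : ψ.IsPrimitive) :
    (∀ k, k % 8 ≠ 0 → gaussSum (ω ^ k) ψ ≠ 0) ∧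
    gaussSum (ω ^ 4) ψ * gaussSum (ω ^ 4) ψ = Fintype.card F ∧
    gaussSum (ω ^ 2) ψ * gaussSum (ω ^ 6) ψ = Fintype.card F ∧
    gaussSum (ω ^ 1) ψ * gaussSum (ω ^ 7) ψ = gaussSum (ω ^ 3) ψ * gaussSum (ω ^ 5) ψ ∧
    ω 4 * ω 4 = 1 ∧
    ω 4 * gaussSum (ω ^ 1) ψ * gaussSum (ω ^ 5) ψ = gaussSum (ω ^ 2) ψ * gaussSum (ω ^ 4) ψ ∧
    ω 4 * gaussSum (ω ^ 3) ψ * gaussSum (ω ^ 7) ψ = gaussSum (ω ^ 6) ψ * gaussSum (ω ^ 4) ψ := by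
  have h2 := two_ne hF
  have h4' : (4 : F) ≠ 0 := by
    rw [show (4 : F) = 2 * 2 by norm_num]; exact mul_ne_zero h2 h2
  have hneg : (-1 : F) ≠ 0 := by simp
  rw [pow_apply_ne 2 h4'] at h4
  rw [pow_apply_ne 2 hneg] at hm
  have hne : ∀ k, k % 8 ≠ 0 → ω ^ k ≠ 1 := fun k hk => pw8_ne ho hk
  have pr : ∀ a b, a % 8 ≠ 0 → (a + b) % 8 = 0 →
      gaussSum (ω ^ a) ψ * gaussSum (ω ^ b) ψ = ω (-1) ^ a * Fintype.card F := by
    intro a b ha hab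
    rw [gauss_prod (hne a ha) _ hψ, pow_apply_ne a hneg]
    rw [← pow_add, ← pow_zero ω]; exact pw8 ho hab
  refine ⟨fun k hk => gauss_ne (hne k hk) hψ, ?_, ?_, ?_, ?_, ?_, ?_⟩
  · rw [pr 4 4 (by norm_num) (by norm_num)]
    linear_combination (Fintype.card F : ℂ) * (ω (-1) ^ 2 + 1) * hm
  · rw [pr 2 6 (by norm_num) (by norm_num), hm, one_mul]
  · rw [pr 1 7 (by norm_num) (by norm_num), pr 3 5 (by norm_num) (by norm_num)]
    linear_combination (-(Fintype.card F : ℂ) * ω (-1)) * hm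
  · linear_combination h4
  · have := HD (ord4 ho) hF hψ (C := ω ^ 1) (by rw [← pow_add]; exact hne _ (by norm_num))
    simp only [← pow_add, pow_apply_ne 1 h4'] at this
    rw [pow_one (ω 4)] at this
    exact this
  · have := HD (ord4 ho) hF hψ (C := ω ^ 3) (by rw [← pow_add]; exact hne _ (by norm_num))
    simp only [← pow_add, pow_apply_ne 3 h4'] at this
    rw [← show ω 4 ^ 3 = ω 4 by linear_combination ω 4 * h4]
    exact this

lemma jac8 {ω : MulChar F ℂ} (ho : orderOf ω = 8) {a b c : ℕ} (h : (a + b) % 8 = c % 8)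
    (hc : c % 8 ≠ 0) (ψ : AddChar F ℂ) : gaussSum (ω ^ c) ψ * jacobiSum (ω ^ a) (ω ^ b) =
      gaussSum (ω ^ a) ψ * gaussSum (ω ^ b) ψ := by
  have h1 : ω ^ a * ω ^ b = ω ^ c := by rw [← pow_add]; exact pw8 ho h
  have := jacobiSum_mul_nontrivial (χ := ω ^ a) (φ := ω ^ b) (by rw [h1]; exact pw8_ne ho hc) ψ
  rwa [h1] at this

lemma selberg8 {ω : MulChar F ℂ} (ho : orderOf ω = 8) (hF : ringChar F ≠ 2)
    {ψ : AddChar F ℂ} (hψ : ψ.IsPrimitive) (a b c e a' b' c' e' x y z : ℕ)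
    (h : (e + a + b + 2 * c) % 8 = 0)
    (ha : a % 8 ≠ 0) (hb : b % 8 ≠ 0) (hc : c % 8 ≠ 0) (he : e % 8 ≠ 0)
    (ha' : (a + a') % 8 = 0) (hb' : (b + b') % 8 = 0) (hc' : (c + c') % 8 = 0)
    (he' : (e + e') % 8 = 0) (hx : (a + c + 4) % 8 = x % 8) (hy : (b + c + 4) % 8 = y % 8)
    (hz : (e + c + 4) % 8 = z % 8) :
    WW (ω ^ a) (ω ^ b) (ω ^ c) * (gaussSum (ω ^ e') ψ * gaussSum (ω ^ a') ψ * gaussSum (ω ^ b') ψ *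
      gaussSum (ω ^ c') ψ) =
    (Fintype.card F : ℂ) * gaussSum (ω ^ 4) ψ * (ω 4) ^ c *
      (gaussSum (ω ^ x) ψ * gaussSum (ω ^ y) ψ * gaussSum (ω ^ z) ψ) := by
  have h2 := two_ne hF
  have h4' : (4 : F) ≠ 0 := by
    rw [show (4 : F) = 2 * 2 by norm_num]; exact mul_ne_zero h2 h2
  have := selberg (ord4 ho) hF hψ (ω ^ a) (ω ^ b) (ω ^ c) (ω ^ e)
    (by rw [← pow_mul, ← pow_add, ← pow_add, ← pow_add, ← pow_zero ω]; exact pw8 ho (by omega))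
    (pw8_ne ho ha) (pw8_ne ho hb) (pw8_ne ho hc) (pw8_ne ho he)
  rw [pw8_inv ho ha', pw8_inv ho hb', pw8_inv ho hc', pw8_inv ho he', ← pow_add, ← pow_add,
    ← pow_add, ← pow_add, ← pow_add, ← pow_add, pw8 ho hx, pw8 ho hy, pw8 ho hz,
    pow_apply_ne c h4'] at this
  exact this

lemma W_a {ω : MulChar F ℂ} (ho : orderOf ω = 8) (hF : ringChar F ≠ 2)
    (h4 : (ω ^ 2) 4 = 1) (hm : (ω ^ 2) (-1) = 1) :
    WW (ω ^ 4) (ω ^ 4) (ω ^ 2) = jacobiSum (ω ^ 2) (ω ^ 4) ^ 2 := by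
  obtain ⟨ψ, hψ⟩ := exists_primitive F
  obtain ⟨hne, h44, h26, h17, hc, hd1, hd3⟩ := octic ho hF h4 hm hψ
  have hs := selberg8 ho hF hψ 4 4 2 4 4 4 6 4 2 2 2 (by norm_num) (by norm_num) (by norm_num)
    (by norm_num) (by norm_num) (by norm_num) (by norm_num) (by norm_num) (by norm_num)
    (by norm_num) (by norm_num) (by norm_num)
  have hj := jac8 ho (a := 2) (b := 4) (c := 6) (by norm_num) (by norm_num) ψ
  have n2 := hne 2 (by norm_num)
  have n4 := hne 4 (by norm_num)
  have n6 := hne 6 (by norm_num)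
  have hj' : jacobiSum (ω ^ 2) (ω ^ 4) = gaussSum (ω ^ 2) ψ * gaussSum (ω ^ 4) ψ /
    gaussSum (ω ^ 6) ψ := by rw [← hj]; field_simp
  rw [hj']
  rw [← h26, show (ω 4) ^ 2 = 1 by rw [sq, hc]] at hs
  rw [← h26] at h44
  generalize gaussSum (ω ^ 2) ψ = g2 at *
  generalize gaussSum (ω ^ 4) ψ = g4 at *
  generalize gaussSum (ω ^ 6) ψ = g6 at *
  field_simp
  have : g4 ^ 3 * g6 ≠ 0 := by positivity
  apply mul_left_cancel₀ this
  linear_combination g6 ^ 2 * hs - g2 ^ 2 * g6 * g4 * (g4 ^ 2 + g2 * g6) * h44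

lemma W_b {ω : MulChar F ℂ} (ho : orderOf ω = 8) (hF : ringChar F ≠ 2)
    (h4 : (ω ^ 2) 4 = 1) (hm : (ω ^ 2) (-1) = 1) :
    WW (ω ^ 6) (ω ^ 4) (ω ^ 1) = jacobiSum (ω ^ 1) (ω ^ 4) ^ 2 := by
  obtain ⟨ψ, hψ⟩ := exists_primitive F
  obtain ⟨hne, h44, h26, h17, hc, hd1, hd3⟩ := octic ho hF h4 hm hψ
  have hs := selberg8 ho hF hψ 6 4 1 4 2 4 7 4 3 1 1 (by norm_num) (by norm_num) (by norm_num)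
    (by norm_num) (by norm_num) (by norm_num) (by norm_num) (by norm_num) (by norm_num)
    (by norm_num) (by norm_num) (by norm_num)
  have hj := jac8 ho (a := 1) (b := 4) (c := 5) (by norm_num) (by norm_num) ψ
  have n1 := hne 1 (by norm_num)
  have n2 := hne 2 (by norm_num)
  have n3 := hne 3 (by norm_num)
  have n4 := hne 4 (by norm_num)
  have n5 := hne 5 (by norm_num)
  have n7 := hne 7 (by norm_num)
  have hj' : jacobiSum (ω ^ 1) (ω ^ 4) = gaussSum (ω ^ 1) ψ * gaussSum (ω ^ 4) ψ /
    gaussSum (ω ^ 5) ψ := by rw [← hj]; field_simp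
  rw [hj']
  rw [← h44, pow_one (ω 4)] at hs
  generalize gaussSum (ω ^ 1) ψ = g1 at *
  generalize gaussSum (ω ^ 2) ψ = g2 at *
  generalize gaussSum (ω ^ 3) ψ = g3 at *
  generalize gaussSum (ω ^ 4) ψ = g4 at *
  generalize gaussSum (ω ^ 5) ψ = g5 at *
  generalize gaussSum (ω ^ 7) ψ = g7 at *
  have e7 : g7 = g3 * g5 / g1 := by field_simp; linear_combination h17
  have e2 : g2 = ω 4 * g1 * g5 / g4 := by field_simp; linear_combination -hd1
  subst e7 e2
  have nc : ω 4 ≠ 0 := by intro h; simp [h] at hc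
  generalize ω 4 = c at *
  field_simp at hs ⊢
  linear_combination hs

lemma W_c {ω : MulChar F ℂ} (ho : orderOf ω = 8) (hF : ringChar F ≠ 2)
    (h4 : (ω ^ 2) 4 = 1) (hm : (ω ^ 2) (-1) = 1) :
    WW (ω ^ 2) (ω ^ 2) (ω ^ 1) = jacobiSum (ω ^ 2) (ω ^ 4) * jacobiSum (ω ^ 7) (ω ^ 4) := by
  obtain ⟨ψ, hψ⟩ := exists_primitive F
  obtain ⟨hne, h44, h26, h17, hc, hd1, hd3⟩ := octic ho hF h4 hm hψ
  have hs := selberg8 ho hF hψ 2 2 1 2 6 6 7 6 7 7 7 (by norm_num) (by norm_num) (by norm_num)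
    (by norm_num) (by norm_num) (by norm_num) (by norm_num) (by norm_num) (by norm_num)
    (by norm_num) (by norm_num) (by norm_num)
  have hj := jac8 ho (a := 2) (b := 4) (c := 6) (by norm_num) (by norm_num) ψ
  have hk := jac8 ho (a := 7) (b := 4) (c := 3) (by norm_num) (by norm_num) ψ
  have n2 := hne 2 (by norm_num)
  have n3 := hne 3 (by norm_num)
  have n4 := hne 4 (by norm_num)
  have n6 := hne 6 (by norm_num)
  have n7 := hne 7 (by norm_num)
  have hj' : jacobiSum (ω ^ 2) (ω ^ 4) = gaussSum (ω ^ 2) ψ * gaussSum (ω ^ 4) ψ /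
    gaussSum (ω ^ 6) ψ := by rw [← hj]; field_simp
  have hk' : jacobiSum (ω ^ 7) (ω ^ 4) = gaussSum (ω ^ 7) ψ * gaussSum (ω ^ 4) ψ /
    gaussSum (ω ^ 3) ψ := by rw [← hk]; field_simp
  rw [hj', hk']
  rw [← h44, pow_one (ω 4)] at hs
  rw [← h44] at h26
  generalize gaussSum (ω ^ 2) ψ = g2 at *
  generalize gaussSum (ω ^ 3) ψ = g3 at *
  generalize gaussSum (ω ^ 4) ψ = g4 at *
  generalize gaussSum (ω ^ 6) ψ = g6 at *
  generalize gaussSum (ω ^ 7) ψ = g7 at *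
  have nc : ω 4 ≠ 0 := by intro h; simp [h] at hc
  generalize ω 4 = c at *
  have e2 : g2 = g4 * g4 / g6 := by field_simp; linear_combination h26
  have e3 : g3 = c * g6 * g4 / g7 := by
    field_simp; linear_combination c * hd3 - g3 * g7 * hc
  subst e2 e3
  field_simp at hs ⊢
  linear_combination c * hs + g4 ^ 3 * g7 ^ 2 * hc

lemma jac13 {ω : MulChar F ℂ} (ho : orderOf ω = 8) (hF : ringChar F ≠ 2)
    (h4 : (ω ^ 2) 4 = 1) (hm : (ω ^ 2) (-1) = 1) :
    jacobiSum (ω ^ 3) (ω ^ 4) = jacobiSum (ω ^ 1) (ω ^ 4) := by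
  obtain ⟨ψ, hψ⟩ := exists_primitive F
  obtain ⟨hne, h44, h26, h17, hc, hd1, hd3⟩ := octic ho hF h4 hm hψ
  have hj := jac8 ho (a := 1) (b := 4) (c := 5) (by norm_num) (by norm_num) ψ
  have hk := jac8 ho (a := 3) (b := 4) (c := 7) (by norm_num) (by norm_num) ψ
  have n5 := hne 5 (by norm_num)
  have n7 := hne 7 (by norm_num)
  apply mul_left_cancel₀ (mul_ne_zero n5 n7)
  linear_combination gaussSum (ω ^ 5) ψ * hk - gaussSum (ω ^ 7) ψ * hj -
    gaussSum (ω ^ 4) ψ * h17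

end PartE2

section PartE3
variable {F : Type*} [Field F] [Fintype F]

lemma oct_pow {ω : MulChar F ℂ} (ho : orderOf ω = 8) (hF : ringChar F ≠ 2)
    (h4 : (ω ^ 2) 4 = 1) (hm : (ω ^ 2) (-1) = 1) (k : ℕ) (hk : k % 2 = 1) :
    orderOf (ω ^ k) = 8 ∧ ((ω ^ k) ^ 2) 4 = 1 ∧ ((ω ^ k) ^ 2) (-1) = 1 := by
  have h2 := two_ne hF
  have h4' : (4 : F) ≠ 0 := by
    rw [show (4 : F) = 2 * 2 by norm_num]; exact mul_ne_zero h2 h2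
  refine ⟨?_, ?_, ?_⟩
  · rw [Nat.Coprime.orderOf_pow, ho]
    rw [ho, show 8 = 2 ^ 3 by norm_num]
    exact Nat.Coprime.pow_left 3 ((Nat.coprime_primes Nat.prime_two Nat.prime_two).2
      |> fun _ => (Nat.coprime_two_left.2 (Nat.odd_iff.2 hk)))
  · rw [pow_right_comm, pow_apply_ne k h4', h4, one_pow]
  · rw [pow_right_comm, pow_apply_ne k (by simp), hm, one_pow]

lemma TT_vals {ω : MulChar F ℂ} (ho : orderOf ω = 8) (hF : ringChar F ≠ 2)
    (h4 : (ω ^ 2) 4 = 1) (hm : (ω ^ 2) (-1) = 1) (χ : MulChar F ℂ) (hχ : χ = ω ^ 2)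
    (p P j j' : ℂ) (hp : p = jacobiSum χ (χ ^ 2)) (hP : P = jacobiSum (χ ^ 3) (χ ^ 2))
    (hj : j = jacobiSum ω (χ ^ 2)) (hj' : j' = jacobiSum (ω ^ 7) (χ ^ 2)) :
    TT (χ ^ 2) (χ ^ 2) (χ ^ 2) (χ ^ 2) (χ ^ 2) = p ^ 2 + P ^ 2 ∧
    TT (χ ^ 3) (χ ^ 2) (χ ^ 3) (χ ^ 2) (χ ^ 1) = j ^ 2 + j' ^ 2 ∧
    TT (χ ^ 1) (χ ^ 1) (χ ^ 1) (χ ^ 1) (χ ^ 1) = p * (j + j') ∧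
    TT (χ ^ 3) (χ ^ 3) (χ ^ 3) (χ ^ 3) (χ ^ 3) = P * (j + j') ∧
    p * P = Fintype.card F ∧ j * j' = Fintype.card F ∧ j = jacobiSum (ω ^ 3) (χ ^ 2) := by
  obtain ⟨o3, q3, m3⟩ := oct_pow ho hF h4 hm 3 rfl
  obtain ⟨o5, q5, m5⟩ := oct_pow ho hF h4 hm 5 rfl
  obtain ⟨o7, q7, m7⟩ := oct_pow ho hF h4 hm 7 rfl
  subst hχ
  have E : ∀ a b k l : ℕ, (a * b) % 8 = (k * l) % 8 → (ω ^ a) ^ b = (ω ^ k) ^ l := by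
    intro a b k l h; rw [← pow_mul, ← pow_mul]; exact pw8 ho h
  have E1 : ∀ a b k : ℕ, (a * b) % 8 = k % 8 → (ω ^ a) ^ b = ω ^ k := by
    intro a b k h; rw [← pow_mul]; exact pw8 ho h
  have hφ := ord4 ho
  have M : ∀ a b : ℕ, ω ^ a * ω ^ b = ω ^ (a + b) := fun a b => (pow_add ω a b).symm
  have hp' : p = jacobiSum (ω ^ 2) (ω ^ 4) := by rw [hp, E1 2 2 4 rfl]
  have hP' : P = jacobiSum (ω ^ 6) (ω ^ 4) := by rw [hP, E1 2 2 4 rfl, E1 2 3 6 rfl]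
  have hjj : j = jacobiSum (ω ^ 1) (ω ^ 4) := by rw [hj, E1 2 2 4 rfl, pow_one]
  have hjj' : j' = jacobiSum (ω ^ 7) (ω ^ 4) := by rw [hj', E1 2 2 4 rfl]
  have j3 : jacobiSum (ω ^ 3) (ω ^ 4) = j := by rw [hjj]; exact jac13 ho hF h4 hm
  have j5 : jacobiSum (ω ^ 5) (ω ^ 4) = j' := by
    have := jac13 o7 hF q7 m7
    rw [E1 7 3 5 rfl, E1 7 4 4 rfl, E1 7 1 7 rfl] at this
    rw [this, hjj']
  have wa1 := W_a ho hF h4 hm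
  have wa3 := W_a o3 hF q3 m3
  have wb1 := W_b ho hF h4 hm
  have wb5 := W_b o5 hF q5 m5
  have wc1 := W_c ho hF h4 hm
  have wc5 := W_c o5 hF q5 m5
  have wc3 := W_c o3 hF q3 m3
  have wc7 := W_c o7 hF q7 m7
  rw [E1 3 4 4 rfl, E1 3 2 6 rfl] at wa3
  rw [E1 5 6 6 rfl, E1 5 4 4 rfl, E1 5 1 5 rfl] at wb5
  rw [E1 5 2 2 rfl, E1 5 4 4 rfl, E1 5 1 5 rfl, E1 5 7 3 rfl] at wc5
  rw [E1 3 2 6 rfl, E1 3 4 4 rfl, E1 3 1 3 rfl, E1 3 7 5 rfl] at wc3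
  rw [E1 7 2 6 rfl, E1 7 4 4 rfl, E1 7 1 7 rfl, E1 7 7 1 rfl] at wc7
  refine ⟨?_, ?_, ?_, ?_, ?_, ?_, ?_⟩
  · have := TT_sym hφ hF (ω ^ 4) (ω ^ 4) (ω ^ 2)
    rw [M, wa1, wa3, ← hp', ← hP', E1 2 2 4 rfl] at this
    rw [E1 2 2 4 rfl]; exact this
  · have := TT_sym hφ hF (ω ^ 6) (ω ^ 4) (ω ^ 1)
    rw [M, wb1, wb5, ← hjj, j5, E1 1 2 2 rfl] at this
    rw [E1 2 2 4 rfl, E1 2 3 6 rfl, pow_one]; exact this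
  · have := TT_sym hφ hF (ω ^ 2) (ω ^ 2) (ω ^ 1)
    rw [M, wc1, wc5, ← hp', ← hjj', j3, E1 1 2 2 rfl] at this
    rw [pow_one, this]; ring
  · have := TT_sym hφ hF (ω ^ 6) (ω ^ 6) (ω ^ 3)
    rw [M, wc3, wc7, ← hP', ← hjj, j5, E1 3 2 6 rfl] at this
    rw [E1 2 3 6 rfl, this]; ring
  · obtain ⟨ψ, hψ⟩ := exists_primitive F
    obtain ⟨hne, h44, h26, h17, hc, hd1, hd3⟩ := octic ho hF h4 hm hψ
    have a1 := jac8 ho (a := 2) (b := 4) (c := 6) (by norm_num) (by norm_num) ψ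
    have a2 := jac8 ho (a := 6) (b := 4) (c := 2) (by norm_num) (by norm_num) ψ
    rw [← hp'] at a1
    rw [← hP'] at a2
    apply mul_left_cancel₀ (mul_ne_zero (hne 6 (by norm_num)) (hne 2 (by norm_num)))
    linear_combination gaussSum (ω ^ 2) ψ * P * a1 + gaussSum (ω ^ 2) ψ * gaussSum (ω ^ 4) ψ * a2
      + gaussSum (ω ^ 2) ψ * gaussSum (ω ^ 6) ψ * h44
  · obtain ⟨ψ, hψ⟩ := exists_primitive F
    obtain ⟨hne, h44, h26, h17, hc, hd1, hd3⟩ := octic ho hF h4 hm hψ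
    have a1 := jac8 ho (a := 1) (b := 4) (c := 5) (by norm_num) (by norm_num) ψ
    have a2 := jac8 ho (a := 7) (b := 4) (c := 3) (by norm_num) (by norm_num) ψ
    rw [← hjj] at a1
    rw [← hjj'] at a2
    apply mul_left_cancel₀ (mul_ne_zero (hne 5 (by norm_num)) (hne 3 (by norm_num)))
    linear_combination gaussSum (ω ^ 3) ψ * j' * a1 + gaussSum (ω ^ 1) ψ * gaussSum (ω ^ 4) ψ * a2
      + gaussSum (ω ^ 1) ψ * gaussSum (ω ^ 7) ψ * h44 + (Fintype.card F : ℂ) * h17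
  · rw [E1 2 2 4 rfl, j3]

end PartE3

section PartF1
variable {F : Type*} [Field F] [Fintype F]

lemma red4 {R : Type*} [CommRing R] (t : R) (ht : t ^ 4 = -1) (k : ℕ) : t ^ k = t ^ (k % 8) := by
  conv_lhs => rw [← Nat.div_add_mod k 8]
  rw [pow_add, pow_mul, show t ^ 8 = 1 by linear_combination (t ^ 4 - 1) * ht, one_pow, one_mul]

lemma red2 {R : Type*} [CommRing R] (t : R) (ht : t ^ 2 = -1) (k : ℕ) : t ^ k = t ^ (k % 4) := by
  conv_lhs => rw [← Nat.div_add_mod k 4]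
  rw [pow_add, pow_mul, show t ^ 4 = 1 by linear_combination (t ^ 2 - 1) * ht, one_pow, one_mul]

lemma single4 (k : ℕ) : ∃ a0 a1 a2 a3 : ℤ, (a0 + a1 + a2 + a3) % 2 = 1 ∧
    (∀ t : ℂ, t ^ 4 = -1 → t ^ k = a0 + a1 * t + a2 * t ^ 2 + a3 * t ^ 3) ∧
    (∀ t : F, t ^ 4 = -1 → t ^ k = a0 + a1 * t + a2 * t ^ 2 + a3 * t ^ 3) := by
  have hk : k % 8 < 8 := Nat.mod_lt _ (by norm_num)
  have key : ∃ a0 a1 a2 a3 : ℤ, (a0 + a1 + a2 + a3) % 2 = 1 ∧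
    (∀ t : ℂ, t ^ 4 = -1 → t ^ (k % 8) = a0 + a1 * t + a2 * t ^ 2 + a3 * t ^ 3) ∧
    (∀ t : F, t ^ 4 = -1 → t ^ (k % 8) = a0 + a1 * t + a2 * t ^ 2 + a3 * t ^ 3) := by
    generalize k % 8 = m at hk
    interval_cases m
    · exact ⟨1, 0, 0, 0, by norm_num, fun t _ => by simp, fun t _ => by simp⟩
    · exact ⟨0, 1, 0, 0, by norm_num, fun t _ => by simp, fun t _ => by simp⟩
    · exact ⟨0, 0, 1, 0, by norm_num, fun t _ => by simp, fun t _ => by simp⟩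
    · exact ⟨0, 0, 0, 1, by norm_num, fun t _ => by simp, fun t _ => by simp⟩
    · exact ⟨-1, 0, 0, 0, by norm_num, fun t h => by push_cast; linear_combination h,
        fun t h => by push_cast; linear_combination h⟩
    · exact ⟨0, -1, 0, 0, by norm_num, fun t h => by push_cast; linear_combination t * h,
        fun t h => by push_cast; linear_combination t * h⟩
    · exact ⟨0, 0, -1, 0, by norm_num, fun t h => by push_cast; linear_combination t ^ 2 * h,
        fun t h => by push_cast; linear_combination t ^ 2 * h⟩
    · exact ⟨0, 0, 0, -1, by norm_num, fun t h => by push_cast; linear_combination t ^ 3 * h,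
        fun t h => by push_cast; linear_combination t ^ 3 * h⟩
  obtain ⟨a0, a1, a2, a3, h1, h2, h3⟩ := key
  exact ⟨a0, a1, a2, a3, h1, fun t ht => by rw [red4 t ht, h2 t ht],
    fun t ht => by rw [red4 t ht, h3 t ht]⟩

lemma single2 (k : ℕ) : ∃ a b : ℤ, (a + b) % 2 = 1 ∧
    (∀ t : ℂ, t ^ 2 = -1 → t ^ k = a + b * t) ∧
    (∀ t : F, t ^ 2 = -1 → t ^ k = a + b * t) := by
  have hk : k % 4 < 4 := Nat.mod_lt _ (by norm_num)
  have key : ∃ a b : ℤ, (a + b) % 2 = 1 ∧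
    (∀ t : ℂ, t ^ 2 = -1 → t ^ (k % 4) = a + b * t) ∧
    (∀ t : F, t ^ 2 = -1 → t ^ (k % 4) = a + b * t) := by
    generalize k % 4 = m at hk
    interval_cases m
    · exact ⟨1, 0, by norm_num, fun t _ => by simp, fun t _ => by simp⟩
    · exact ⟨0, 1, by norm_num, fun t _ => by simp, fun t _ => by simp⟩
    · exact ⟨-1, 0, by norm_num, fun t h => by push_cast; linear_combination h,
        fun t h => by push_cast; linear_combination h⟩
    · exact ⟨0, -1, by norm_num, fun t h => by push_cast; linear_combination t * h,
        fun t h => by push_cast; linear_combination t * h⟩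
  obtain ⟨a0, a1, h1, h2, h3⟩ := key
  exact ⟨a0, a1, h1, fun t ht => by rw [red2 t ht, h2 t ht],
    fun t ht => by rw [red2 t ht, h3 t ht]⟩

lemma many4 (N : Finset F) (κ : F → ℕ) : ∃ a0 a1 a2 a3 : ℤ,
    (a0 + a1 + a2 + a3 - N.card) % 2 = 0 ∧
    (∀ t : ℂ, t ^ 4 = -1 → ∑ x ∈ N, t ^ κ x = a0 + a1 * t + a2 * t ^ 2 + a3 * t ^ 3) ∧
    (∀ t : F, t ^ 4 = -1 → ∑ x ∈ N, t ^ κ x = a0 + a1 * t + a2 * t ^ 2 + a3 * t ^ 3) := by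
  classical
  induction N using Finset.induction_on with
  | empty => exact ⟨0, 0, 0, 0, by simp, by simp, by simp⟩
  | insert x s hx ih =>
    obtain ⟨a0, a1, a2, a3, h1, h2, h3⟩ := ih
    obtain ⟨b0, b1, b2, b3, k1, k2, k3⟩ := single4 (F := F) (κ x)
    refine ⟨a0 + b0, a1 + b1, a2 + b2, a3 + b3, ?_, fun t ht => ?_, fun t ht => ?_⟩
    · rw [Finset.card_insert_of_notMem hx]; push_cast; omega
    · rw [Finset.sum_insert hx, h2 t ht, k2 t ht]; push_cast; ring
    · rw [Finset.sum_insert hx, h3 t ht, k3 t ht]; push_cast; ring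

lemma many2 (N : Finset F) (κ : F → ℕ) : ∃ a b : ℤ,
    (a + b - N.card) % 2 = 0 ∧
    (∀ t : ℂ, t ^ 2 = -1 → ∑ x ∈ N, t ^ κ x = a + b * t) ∧
    (∀ t : F, t ^ 2 = -1 → ∑ x ∈ N, t ^ κ x = a + b * t) := by
  classical
  induction N using Finset.induction_on with
  | empty => exact ⟨0, 0, by simp, by simp, by simp⟩
  | insert x s hx ih =>
    obtain ⟨a0, a1, h1, h2, h3⟩ := ih
    obtain ⟨b0, b1, k1, k2, k3⟩ := single2 (F := F) (κ x)
    refine ⟨a0 + b0, a1 + b1, ?_, fun t ht => ?_, fun t ht => ?_⟩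
    · rw [Finset.card_insert_of_notMem hx]; push_cast; omega
    · rw [Finset.sum_insert hx, h2 t ht, k2 t ht]; push_cast; ring
    · rw [Finset.sum_insert hx, h3 t ht, k3 t ht]; push_cast; ring

/-- the set of `x` such that `1 - x` is a non-square -/
def NR (F : Type*) [Field F] [Fintype F] [DecidableEq F] : Finset F :=
  Finset.univ.filter fun x => quadraticChar F (1 - x) = -1

lemma sum_NR [DecidableEq F] {R : Type*} [CommRing R] (f : F → R) (h1 : f 1 = 1)
    (h0 : ∑ x, f x = 0) :
    ∑ x, f x * (quadraticChar F (1 - x) : R) = -1 - 2 * ∑ x ∈ NR F, f x := by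
  have e : ∀ x : F, f x * (quadraticChar F (1 - x) : R) =
      f x - (if x = 1 then f 1 else 0) - 2 * (if quadraticChar F (1 - x) = -1 then f x else 0) := by
    intro x
    by_cases hx : x = 1
    · subst hx; simp
    · have : 1 - x ≠ 0 := sub_ne_zero.2 (Ne.symm hx)
      rcases quadraticChar_dichotomy this with h | h
      · rw [h]; simp [hx]
      · rw [h]; simp [hx]; ring
  rw [Finset.sum_congr rfl fun x _ => e x, Finset.sum_sub_distrib, Finset.sum_sub_distrib, h0,
    ← Finset.mul_sum, NR, Finset.sum_filter]
  simp [h1]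

lemma card_NR [DecidableEq F] (hF : ringChar F ≠ 2) :
    2 * ((NR F).card : ℤ) = Fintype.card F - 1 := by
  have h := quadraticChar_sum_zero hF
  have e : ∀ x : F, quadraticChar F (1 - x) =
      1 - (if x = 1 then 1 else 0) - 2 * (if quadraticChar F (1 - x) = -1 then 1 else 0) := by
    intro x
    by_cases hx : x = 1
    · subst hx; simp
    · have : 1 - x ≠ 0 := sub_ne_zero.2 (Ne.symm hx)
      rcases quadraticChar_dichotomy this with h | h
      · rw [h]; simp [hx]
      · rw [h]; simp [hx]
  have h' : ∑ x : F, quadraticChar F (1 - x) = 0 := by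
    rw [← h]; exact Fintype.sum_equiv (Equiv.subLeft 1) _ _ fun x => rfl
  rw [Finset.sum_congr rfl fun x _ => e x, Finset.sum_sub_distrib, Finset.sum_sub_distrib,
    ← Finset.mul_sum, ← Finset.sum_filter (s := Finset.univ)
      (p := fun x : F => quadraticChar F (1 - x) = -1)] at h'
  simp [-quadraticChar_apply] at h'
  unfold NR
  linarith

lemma sum_pow_all {i : ℕ} (hi : 0 < i) :
    ∑ x : F, x ^ i = if (Fintype.card F - 1) ∣ i then (-1 : F) else 0 := by
  classical
  rw [← FiniteField.sum_pow_units F i]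
  have h := Finset.sum_map (Finset.univ : Finset Fˣ) ⟨Units.val, Units.val_injective⟩
    (fun x : F => x ^ i)
  simp only [Function.Embedding.coeFn_mk] at h
  rw [← h]
  refine (Finset.sum_subset (Finset.subset_univ _) fun x _ hx => ?_).symm
  have : x = 0 := by
    by_contra h0
    exact hx (Finset.mem_map.2 ⟨Units.mk0 x h0, Finset.mem_univ _, rfl⟩)
  rw [this, zero_pow hi.ne']

lemma sumJ (A M : ℕ) (hA : 0 < A) : ∑ x : F, x ^ A * (1 - x) ^ M =
    ∑ i ∈ Finset.range (M + 1), (-1) ^ i * (M.choose i : F) *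
      (if (Fintype.card F - 1) ∣ (A + i) then (-1 : F) else 0) := by
  have e : ∀ x : F, x ^ A * (1 - x) ^ M =
      ∑ i ∈ Finset.range (M + 1), (-1) ^ i * (M.choose i : F) * x ^ (A + i) := by
    intro x
    rw [show 1 - x = -x + 1 by ring, add_pow, Finset.mul_sum]
    refine Finset.sum_congr rfl fun i _ => ?_
    rw [neg_pow, pow_add]; ring
  rw [Finset.sum_congr rfl fun x _ => e x, Finset.sum_comm]
  refine Finset.sum_congr rfl fun i _ => ?_
  rw [← Finset.mul_sum, sum_pow_all (by omega)]

lemma sumJ0 (A M : ℕ) (hA : 0 < A) (h : A + M < Fintype.card F - 1) :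
    ∑ x : F, x ^ A * (1 - x) ^ M = 0 := by
  rw [sumJ A M hA]
  refine Finset.sum_eq_zero fun i hi => ?_
  rw [Finset.mem_range] at hi
  rw [if_neg, mul_zero]
  intro hd
  have := Nat.le_of_dvd (by omega) hd
  omega

lemma sumJ1 (A M i₀ : ℕ) (hA : 0 < A) (h : A + i₀ = Fintype.card F - 1) (hi : i₀ ≤ M)
    (h2 : A + M < 2 * (Fintype.card F - 1)) :
    ∑ x : F, x ^ A * (1 - x) ^ M = -((-1) ^ i₀ * (M.choose i₀ : F)) := by
  rw [sumJ A M hA, Finset.sum_eq_single i₀]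
  · rw [if_pos (by rw [h])]; ring
  · intro i hi hne
    rw [Finset.mem_range] at hi
    rw [if_neg, mul_zero]
    rintro ⟨c, hc⟩
    have c0 : c ≠ 0 := by rintro rfl; omega
    have c1 : c ≠ 1 := by rintro rfl; omega
    have c2 : 2 ≤ c := by omega
    have := Nat.mul_le_mul_left (Fintype.card F - 1) c2
    omega
  · intro h'; exact absurd (Finset.mem_range.2 (by omega)) h'

/-- arithmetic of the quartic and octic Jacobi sums -/
lemma jacobi_arith [DecidableEq F] {ω : MulChar F ℂ} (ho : orderOf ω = 8) (hF : ringChar F ≠ 2) (n : ℕ)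
    (hn : Fintype.card F = 8 * n + 1) (χ : MulChar F ℂ) (hχ : χ = ω ^ 2)
    (p P j j' : ℂ) (hp : p = jacobiSum χ (χ ^ 2)) (hP : P = jacobiSum (χ ^ 3) (χ ^ 2))
    (hj : j = jacobiSum ω (χ ^ 2)) (hj' : j' = jacobiSum (ω ^ 7) (χ ^ 2))
    (hpP : p * P = Fintype.card F) (hjj : j * j' = Fintype.card F)
    (hj3 : j = jacobiSum (ω ^ 3) (χ ^ 2)) :
    (∃ m b : ℤ, p + P = 2 * m ∧ m ^ 2 + 4 * b ^ 2 = Fintype.card F ∧ m % 4 = 3 ∧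
      (2 * m : F) = -((-1) ^ (2 * n) * ((4 * n).choose (2 * n) : F))) ∧
    (∃ m b : ℤ, j + j' = 2 * m ∧ m ^ 2 + 2 * b ^ 2 = Fintype.card F ∧ m % 4 = 3 ∧
      (2 * m : F) = -((-1) ^ n * ((4 * n).choose n : F))) := by
  have hn0 : 0 < n := by
    rcases Nat.eq_zero_or_pos n with h | h
    · subst h
      have := Fintype.one_lt_card (α := F); omega
    · exact h
  obtain ⟨g, hg⟩ := IsCyclic.exists_generator (α := Fˣ)
  have hlog : ∀ x : F, ∃ k : ℕ, x ≠ 0 → x = (g : F) ^ k := by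
    intro x
    by_cases hx : x = 0
    · exact ⟨0, fun h => absurd hx h⟩
    · obtain ⟨k, hk⟩ : Units.mk0 x hx ∈ Submonoid.powers g := by
        rw [mem_powers_iff_mem_zpowers]; apply hg
      refine ⟨k, fun _ => ?_⟩
      have := congrArg Units.val hk
      simpa using this.symm
  choose κ hκ using hlog
  have hφ := ord4 ho
  have hχ2 : χ ^ 2 = ω ^ 4 := by rw [hχ, ← pow_mul]
  rw [hχ2] at hp hP hj hj' hj3
  have hord : orderOf g = 8 * n := by
    rw [orderOf_eq_card_of_forall_mem_zpowers hg, Nat.card_eq_fintype_card, Fintype.card_units, hn]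
    simp
  -- the two eighth roots of unity
  set ζ : ℂ := ω g with hζ
  set Z : F := (g : F) ^ n with hZ
  have g0 : (g : F) ≠ 0 := g.ne_zero
  have hζ8 : ζ ^ 8 = 1 := by
    rw [hζ, ← pow_apply_ne 8 g0, ← ho, pow_orderOf_eq_one, MulChar.one_apply g.isUnit]
  have hζ4 : ζ ^ 4 = -1 := by
    have h1 : ζ ^ 4 ≠ 1 := by
      intro h
      rw [hζ, ← pow_apply_ne 4 g0, char_eq_one_iff hφ] at h
      obtain ⟨w, hw⟩ := h
      have hw' : g = w ^ 2 := Units.ext (by simpa using hw)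
      have h2 : g ^ (4 * n) = 1 := by
        rw [hw', ← pow_mul, show 2 * (4 * n) = Fintype.card Fˣ by rw [Fintype.card_units, hn]; omega,
          pow_card_eq_one]
      have := orderOf_le_of_pow_eq_one (by omega) h2
      omega
    have h2 : (ζ ^ 4 - 1) * (ζ ^ 4 + 1) = 0 := by linear_combination hζ8
    rcases mul_eq_zero.1 h2 with h | h
    · exact absurd (by linear_combination h) h1
    · linear_combination h
  have hZ4 : Z ^ 4 = -1 := by
    have h1 : Z ^ 4 ≠ 1 := by
      intro h
      rw [hZ, ← pow_mul] at h
      have h2 : g ^ (n * 4) = 1 := Units.ext (by simpa using h)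
      have := orderOf_le_of_pow_eq_one (by omega) h2
      omega
    have h8 : Z ^ 8 = 1 := by
      rw [hZ, ← pow_mul]
      have : g ^ (n * 8) = 1 := by rw [mul_comm, ← hord, pow_orderOf_eq_one]
      simpa using congrArg Units.val this
    have h2 : (Z ^ 4 - 1) * (Z ^ 4 + 1) = 0 := by linear_combination h8
    rcases mul_eq_zero.1 h2 with h | h
    · exact absurd (by linear_combination h) h1
    · linear_combination h
  have nr0 : ∀ x ∈ NR F, x ≠ 0 := by
    rintro x hx rfl
    simp [NR] at hx
  -- sums in the complex numbers
  have SC : ∀ k, k % 8 ≠ 0 → jacobiSum (ω ^ k) (ω ^ 4) = -1 - 2 * ∑ x ∈ NR F, (ζ ^ k) ^ κ x := by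
    intro k hk
    have h := sum_NR (F := F) (fun x => (ω ^ k) x) (by simp) (sum_mc (pw8_ne ho hk))
    unfold jacobiSum
    rw [Finset.sum_congr rfl fun x _ => by rw [quad_values hφ]]
    rw [h]
    congr 2
    refine Finset.sum_congr rfl fun x hx => ?_
    have hx0 := nr0 x hx
    rw [pow_apply_ne k hx0]
    conv_lhs => rw [hκ x hx0]
    rw [map_pow, ← pow_mul, ← pow_mul, mul_comm]
  have hcard2 : Fintype.card F / 2 = 4 * n := by omega
  have SF : ∀ k, 0 < k → k < 8 → ∑ x : F, x ^ (k * n) * (1 - x) ^ (4 * n) =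
      -1 - 2 * ∑ x ∈ NR F, (Z ^ k) ^ κ x := by
    intro k hk hk8
    have kn : 0 < k * n := Nat.mul_pos hk hn0
    have h := sum_NR (F := F) (fun x => x ^ (k * n)) (by simp) (by
      rw [sum_pow_all kn, if_neg]
      intro hd
      have := Nat.le_of_dvd kn hd
      have : k * n < 8 * n := Nat.mul_lt_mul_of_pos_right hk8 hn0
      omega)
    simp only [quadraticChar_eq_pow_of_char_ne_two' hF, hcard2] at h
    rw [h]
    congr 2
    refine Finset.sum_congr rfl fun x hx => ?_
    have hx0 := nr0 x hx
    conv_lhs => rw [hκ x hx0]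
    rw [hZ, ← pow_mul, ← pow_mul, ← pow_mul]; congr 1; ring
  have hN := card_NR hF
  rw [hn] at hN
  push_cast at hN
  constructor
  · obtain ⟨a, b, h1, h2, h3⟩ := many2 (NR F) κ
    have i1 : (ζ ^ 2) ^ 2 = -1 := by rw [← pow_mul]; exact hζ4
    have i2 : (ζ ^ 6) ^ 2 = -1 := by linear_combination (ζ ^ 8 - ζ ^ 4 + 1) * hζ4
    have I1 : (Z ^ 2) ^ 2 = -1 := by rw [← pow_mul]; exact hZ4
    have I2 : (Z ^ 6) ^ 2 = -1 := by linear_combination (Z ^ 8 - Z ^ 4 + 1) * hZ4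
    have e1 : p = -1 - 2 * (a + b * ζ ^ 2) := by
      rw [hp, hχ, SC 2 (by norm_num), h2 _ i1]
    have e2 : P = -1 - 2 * (a - b * ζ ^ 2) := by
      rw [hP, hχ, ← pow_mul, SC 6 (by norm_num), h2 _ i2]
      linear_combination (-2 * b * ζ ^ 2) * hζ4
    have eq : (-1 - 2 * a) ^ 2 + 4 * b ^ 2 = (Fintype.card F : ℤ) := by
      rw [e1, e2] at hpP
      have : (((-1 - 2 * a) ^ 2 + 4 * b ^ 2 : ℤ) : ℂ) = (Fintype.card F : ℤ) := by
        push_cast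
        linear_combination hpP + (4 * b ^ 2 : ℂ) * hζ4
      exact_mod_cast this
    refine ⟨-1 - 2 * a, b, by rw [e1, e2]; push_cast; ring, eq, ?_, ?_⟩
    · rw [hn] at eq
      push_cast at eq
      have hb : b % 2 = 0 := by
        by_contra hb
        have hb1 : b % 2 = 1 := by omega
        obtain ⟨c, hc⟩ : ∃ c, b = 2 * c + 1 := ⟨b / 2, by omega⟩
        obtain ⟨d, hd⟩ : ∃ d, a * (a + 1) = 2 * d := (Int.even_mul_succ_self a).exists_two_nsmul
          |>.imp fun d hd => by simpa using hd
        have : 4 * (a * (a + 1)) + 4 * (4 * (c * c + c) + 1) = 8 * (n : ℤ) := by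
          rw [hc] at eq; linear_combination eq
        rw [hd] at this
        omega
      omega
    · have f1 := SF 2 (by norm_num) (by norm_num)
      have f2 := SF 6 (by norm_num) (by norm_num)
      rw [h3 _ I1, sumJ0 _ _ (by omega) (by omega)] at f1
      rw [h3 _ I2, sumJ1 _ _ (2 * n) (by omega) (by omega) (by omega) (by omega)] at f2
      rw [f2]
      push_cast
      linear_combination -f1 + (2 * b * Z ^ 2 : F) * hZ4
  · obtain ⟨a0, a1, a2, a3, h1, h2, h3⟩ := many4 (NR F) κ
    have i3 : (ζ ^ 3) ^ 4 = -1 := by linear_combination (ζ ^ 8 - ζ ^ 4 + 1) * hζ4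
    have i7 : (ζ ^ 7) ^ 4 = -1 := by
      linear_combination (ζ ^ 24 - ζ ^ 20 + ζ ^ 16 - ζ ^ 12 + ζ ^ 8 - ζ ^ 4 + 1) * hζ4
    have I7 : (Z ^ 7) ^ 4 = -1 := by
      linear_combination (Z ^ 24 - Z ^ 20 + Z ^ 16 - Z ^ 12 + Z ^ 8 - Z ^ 4 + 1) * hZ4
    have e1 : j = -1 - 2 * (a0 + a1 * ζ + a2 * ζ ^ 2 + a3 * ζ ^ 3) := by
      rw [hj]
      have := SC 1 (by norm_num)
      rw [pow_one, pow_one, h2 _ hζ4] at this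
      exact this
    have e3 : j = -1 - 2 * (a0 + a1 * ζ ^ 3 + a2 * (ζ ^ 3) ^ 2 + a3 * (ζ ^ 3) ^ 3) := by
      rw [hj3, SC 3 (by norm_num), h2 _ i3]
    have e7 : j' = -1 - 2 * (a0 + a1 * ζ ^ 7 + a2 * (ζ ^ 7) ^ 2 + a3 * (ζ ^ 7) ^ 3) := by
      rw [hj', SC 7 (by norm_num), h2 _ i7]
    have hlin : ((a1 - a3 : ℤ) : ℂ) * (ζ - ζ ^ 3) = -2 * a2 * ζ ^ 2 := by
      push_cast
      linear_combination (e1 - e3) * (1 / 2 : ℂ) +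
        (a2 * ζ ^ 2 + a3 * ζ * (ζ ^ 4 - 1) : ℂ) * hζ4
    have hsq : 2 * (a1 - a3) ^ 2 + 4 * a2 ^ 2 = 0 := by
      have : ((2 * (a1 - a3) ^ 2 + 4 * a2 ^ 2 : ℤ) : ℂ) = 0 := by
        have h5 := congrArg (· ^ 2) hlin
        push_cast at h5 ⊢
        linear_combination h5 + (4 * a2 ^ 2 - (a1 - a3) ^ 2 * (ζ ^ 2 - 2) : ℂ) * hζ4
      exact_mod_cast this
    have ha2 : a2 = 0 := by nlinarith [sq_nonneg (a1 - a3), sq_nonneg a2]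
    have ha1 : a3 = a1 := by
      have : (a1 - a3) ^ 2 = 0 := by nlinarith [sq_nonneg (a1 - a3), sq_nonneg a2]
      have := pow_eq_zero_iff (two_ne_zero) |>.1 this
      omega
    subst ha2
    subst ha1
    have e1' : j = (-1 - 2 * a0) - 2 * a3 * (ζ + ζ ^ 3) := by
      rw [e1]; push_cast; ring
    have e7' : j' = (-1 - 2 * a0) + 2 * a3 * (ζ + ζ ^ 3) := by
      rw [e7]; push_cast
      linear_combination (-2 * a3 * ζ ^ 3 - 2 * a3 * ζ * (ζ ^ 16 - ζ ^ 12 + ζ ^ 8 - ζ ^ 4 + 1) : ℂ)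
        * hζ4
    refine ⟨-1 - 2 * a0, 2 * a3, by rw [e1', e7']; push_cast; ring, ?_, by omega, ?_⟩
    · have : (((-1 - 2 * a0) ^ 2 + 2 * (2 * a3) ^ 2 : ℤ) : ℂ) = (Fintype.card F : ℤ) := by
        rw [e1', e7'] at hjj
        push_cast
        linear_combination hjj + (4 * a3 ^ 2 * (ζ ^ 2 + 2) : ℂ) * hζ4
      exact_mod_cast this
    · have f1 := SF 1 (by norm_num) (by norm_num)
      have f7 := SF 7 (by norm_num) (by norm_num)
      rw [pow_one, h3 _ hZ4, sumJ0 _ _ (by omega) (by omega)] at f1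
      rw [h3 _ I7, sumJ1 _ _ n (by omega) (by omega) (by omega) (by omega)] at f7
      rw [f7]
      push_cast at f1 ⊢
      linear_combination -f1 + (2 * a3 * Z ^ 3 +
        2 * a3 * Z * (Z ^ 16 - Z ^ 12 + Z ^ 8 - Z ^ 4 + 1) : F) * hZ4

end PartF1

section PartF2

lemma lucas_step {p : ℕ} (hp : p.Prime) {A B D d : ℕ} (hD : D < p) (hd : d ≤ D)
    (h : ¬ p ∣ A.choose B) : ¬ p ∣ (p * A + D).choose (p * B + d) := by
  have := Fact.mk hp
  have hl := Choose.choose_modEq_choose_mod_mul_choose_div_nat (n := p * A + D) (k := p * B + d) (p := p)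
  rw [Nat.mul_add_mod, Nat.mul_add_mod, Nat.mod_eq_of_lt hD, Nat.mod_eq_of_lt (hd.trans_lt hD),
    Nat.mul_add_div hp.pos, Nat.mul_add_div hp.pos, Nat.div_eq_of_lt hD,
    Nat.div_eq_of_lt (hd.trans_lt hD), add_zero, add_zero] at hl
  rw [(hl.dvd_iff dvd_rfl), hp.dvd_mul]
  rintro (h1 | h1)
  · have h2 : p ∣ D.factorial := by
      rw [← Nat.choose_mul_factorial_mul_factorial hd, mul_assoc]
      exact h1.mul_right _
    rw [hp.dvd_factorial] at h2
    omega
  · exact h h1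

lemma nd4 {p : ℕ} (hp : p.Prime) (h4 : p % 4 = 1) : ∀ r m : ℕ, p ^ r = 4 * m + 1 →
    ¬ p ∣ (2 * m).choose m := by
  intro r
  induction r with
  | zero =>
    intro m hm
    have : m = 0 := by simpa using hm
    subst this
    simpa using hp.one_lt.ne'
  | succ r ih =>
    intro m hm
    obtain ⟨k, hk⟩ : ∃ k, p = 4 * k + 1 := ⟨p / 4, by omega⟩
    have h1 : p ^ r % 4 = 1 := by
      rw [Nat.pow_mod, h4]; simp
    obtain ⟨m', hm'⟩ : ∃ m', p ^ r = 4 * m' + 1 := ⟨p ^ r / 4, by omega⟩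
    have hh := lucas_step hp (D := 2 * k) (d := k) (by omega) (by omega) (ih m' hm')
    have hmm : m = p * m' + k := by
      rw [pow_succ, hm'] at hm
      have : 4 * m = 4 * (p * m' + k) := by
        have : (4 * m' + 1) * p = 4 * (p * m') + p := by ring
        omega
      omega
    rw [hmm]
    convert hh using 2
    ring_nf

lemma nd8 {p : ℕ} (hp : p.Prime) (h4 : p % 8 = 1) : ∀ r m : ℕ, p ^ r = 8 * m + 1 →
    ¬ p ∣ (4 * m).choose m := by
  intro r
  induction r with
  | zero =>
    intro m hm
    have : m = 0 := by simpa using hm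
    subst this
    simpa using hp.one_lt.ne'
  | succ r ih =>
    intro m hm
    obtain ⟨k, hk⟩ : ∃ k, p = 8 * k + 1 := ⟨p / 8, by omega⟩
    have h1 : p ^ r % 8 = 1 := by
      rw [Nat.pow_mod, h4]; simp
    obtain ⟨m', hm'⟩ : ∃ m', p ^ r = 8 * m' + 1 := ⟨p ^ r / 8, by omega⟩
    have hh := lucas_step hp (D := 4 * k) (d := k) (by omega) (by omega) (ih m' hm')
    have hmm : m = p * m' + k := by
      rw [pow_succ, hm'] at hm
      have : 8 * m = 8 * (p * m' + k) := by
        have : (8 * m' + 1) * p = 8 * (p * m') + p := by ring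
        omega
      omega
    rw [hmm]
    convert hh using 2
    ring_nf

lemma nd83 {p : ℕ} (hp : p.Prime) (h4 : p % 8 = 3) : ∀ r m : ℕ, (p ^ 2) ^ r = 8 * m + 1 →
    ¬ p ∣ (4 * m).choose m := by
  intro r
  induction r with
  | zero =>
    intro m hm
    have : m = 0 := by simpa using hm
    subst this
    simpa using hp.one_lt.ne'
  | succ r ih =>
    intro m hm
    obtain ⟨k, hk⟩ : ∃ k, p = 8 * k + 3 := ⟨p / 8, by omega⟩
    have h1 : (p ^ 2) ^ r % 8 = 1 := by
      rw [Nat.pow_mod, Nat.pow_mod p, h4]; simp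
    obtain ⟨m', hm'⟩ : ∃ m', (p ^ 2) ^ r = 8 * m' + 1 := ⟨(p ^ 2) ^ r / 8, by omega⟩
    have hh := lucas_step hp (D := 4 * k + 1) (d := k) (by omega) (by omega) (ih m' hm')
    have hh := lucas_step hp (D := 4 * k + 1) (d := 3 * k + 1) (by omega) (by omega) hh
    have hmm : m = p * (p * m' + k) + (3 * k + 1) := by
      rw [pow_succ, hm'] at hm
      have : 8 * m = 8 * (p * (p * m' + k) + (3 * k + 1)) := by
        have h2 : (8 * m' + 1) * p ^ 2 = 8 * (p * (p * m')) + p ^ 2 := by ring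
        have h3 : p ^ 2 = 8 * (p * k) + 8 * (3 * k + 1) + 1 := by rw [hk]; ring
        rw [mul_add p]
        omega
      omega
    rw [hmm]
    convert hh using 2
    rw [hk]; ring

lemma uniq_split {p : ℕ} (hp : p.Prime) (r : ℕ) {c c' x y z w : ℤ} (hc : 0 < c) (hcc : c = 2 * c')
    (hodd : p % 2 = 1) (h1 : x ^ 2 + c * y ^ 2 = (p : ℤ) ^ r) (h2 : z ^ 2 + c * w ^ 2 = (p : ℤ) ^ r)
    (hx : ¬ (p : ℤ) ∣ x) (hz : ¬ (p : ℤ) ∣ z) : x ^ 2 = z ^ 2 := by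
  have hpp : Prime (p : ℤ) := Nat.prime_iff_prime_int.1 hp
  have hp2 : ¬ (p : ℤ) ∣ 2 := by
    intro h
    have h' : p ∣ 2 := by exact_mod_cast h
    rcases (Nat.dvd_prime Nat.prime_two).1 h' with h | h
    · exact hp.one_lt.ne' h
    · omega
  have hq : 0 < (p : ℤ) ^ r := by have := hp.pos; positivity
  have qodd : ¬ (2 : ℤ) ∣ (p : ℤ) ^ r := by
    intro h
    have := Int.prime_two.dvd_of_dvd_pow h
    omega
  -- one of the factors is divisible by `q`
  have key : ∀ w : ℤ, z ^ 2 + c * w ^ 2 = (p : ℤ) ^ r → (p : ℤ) ^ r ∣ x * z - c * y * w →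
      x ^ 2 = z ^ 2 := by
    rintro w h2 ⟨k, hk⟩
    have e : ((p : ℤ) ^ r * k) ^ 2 + c * (x * w + y * z) ^ 2 = ((p : ℤ) ^ r) ^ 2 := by
      rw [← hk]
      linear_combination (z ^ 2 + c * w ^ 2) * h1 + (p : ℤ) ^ r * h2
    generalize (p : ℤ) ^ r = Q at *
    have hk0 : k ≠ 0 := by
      rintro rfl
      apply qodd
      apply Int.prime_two.dvd_of_dvd_pow (n := 2)
      exact ⟨c' * (x * w + y * z) ^ 2, by rw [← e, hcc]; ring⟩
    have hk1 : 1 ≤ k ^ 2 := by have := sq_pos_of_ne_zero hk0; omega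
    have h0 : (x * w + y * z) ^ 2 ≤ 0 := by
      nlinarith [sq_nonneg (x * w + y * z), mul_le_mul_of_nonneg_left hk1 (sq_nonneg Q)]
    have h0' : x * w + y * z = 0 := pow_eq_zero_iff two_ne_zero |>.1 (le_antisymm h0 (sq_nonneg _))
    have : Q * (x ^ 2 - z ^ 2) = 0 := by
      linear_combination (-x ^ 2) * h2 + z ^ 2 * h1 + c * (x * w - y * z) * h0'
    rcases mul_eq_zero.1 this with h | h
    · omega
    · omega
  have prod : (p : ℤ) ^ r ∣ (x * z - c * y * w) * (x * z + c * y * w) :=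
    ⟨x ^ 2 + z ^ 2 - (p : ℤ) ^ r, by
      linear_combination (z ^ 2 - (p:ℤ) ^ r) * h1 - c * y ^ 2 * h2⟩
  by_cases hd : (p : ℤ) ∣ x * z + c * y * w
  · have hd' : ¬ (p : ℤ) ∣ x * z - c * y * w := by
      intro hd'
      have : (p : ℤ) ∣ 2 * (x * z) := by
        have := dvd_add hd hd'
        ring_nf at this ⊢
        exact this
      rcases hpp.dvd_or_dvd this with h | h
      · exact hp2 h
      · rcases hpp.dvd_or_dvd h with h | h
        · exact hx h
        · exact hz h
    have cop : IsCoprime ((p : ℤ) ^ r) (x * z - c * y * w) :=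
      ((Prime.coprime_iff_not_dvd hpp).2 hd').pow_left
    refine key (-w) (by linear_combination h2) ?_
    have := cop.dvd_of_dvd_mul_left prod
    rwa [show x * z - c * y * -w = x * z + c * y * w by ring]
  · have cop : IsCoprime ((p : ℤ) ^ r) (x * z + c * y * w) :=
      ((Prime.coprime_iff_not_dvd hpp).2 hd).pow_left
    exact key w h2 (cop.dvd_of_dvd_mul_right prod)

lemma inert {p : ℕ} (hp : p.Prime) {c : ℤ} (hc : 1 < c)
    (hi : ∀ a b : ℤ, (p : ℤ) ∣ a ^ 2 + c * b ^ 2 → (p : ℤ) ∣ a ∧ (p : ℤ) ∣ b) :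
    ∀ r : ℕ, ∀ x y : ℤ, x ^ 2 + c * y ^ 2 = (p : ℤ) ^ r → x ^ 2 = (p : ℤ) ^ r := by
  have hp0 : (p : ℤ) ≠ 0 := by exact_mod_cast hp.ne_zero
  intro r
  induction r using Nat.strong_induction_on with
  | _ r ih =>
    intro x y h
    rcases r with _ | r
    · simp only [pow_zero] at h ⊢
      have : y ^ 2 < 1 := by nlinarith [sq_nonneg x, sq_nonneg y]
      have hy : y ^ 2 = 0 := by have := sq_nonneg y; omega
      rw [hy] at h; linarith
    · obtain ⟨⟨a, rfl⟩, ⟨b, rfl⟩⟩ := hi x y (h ▸ dvd_pow_self _ (Nat.succ_ne_zero r))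
      rcases r with _ | r
      · exfalso
        have h' : (p : ℤ) * (p * (a ^ 2 + c * b ^ 2)) = p * 1 := by linear_combination h
        have h'' := mul_left_cancel₀ hp0 h'
        have := Int.isUnit_iff.1 (IsUnit.of_mul_eq_one _ h'')
        have := hp.one_lt
        omega
      · have h' : (p : ℤ) ^ 2 * (a ^ 2 + c * b ^ 2) = p ^ 2 * p ^ r := by
          rw [← pow_add]; rw [show 2 + r = r + 1 + 1 by ring]; linear_combination h
        have h'' := mul_left_cancel₀ (pow_ne_zero 2 hp0) h'
        have := ih r (by omega) a b h''
        rw [mul_pow, this]; ring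

lemma inert4 {p : ℕ} (hp : p.Prime) (h4 : p % 4 = 3) (a b : ℤ) (h : (p : ℤ) ∣ a ^ 2 + 4 * b ^ 2) :
    (p : ℤ) ∣ a ∧ (p : ℤ) ∣ b := by
  have := Fact.mk hp
  have h2 : (2 : ZMod p) ≠ 0 := by
    intro h2
    have h2' : ((2 : ℕ) : ZMod p) = 0 := by exact_mod_cast h2
    rw [ZMod.natCast_eq_zero_iff] at h2'
    have := (Nat.prime_dvd_prime_iff_eq hp Nat.prime_two).1 h2'
    omega
  simp only [← ZMod.intCast_zmod_eq_zero_iff_dvd] at h ⊢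
  push_cast at h
  by_cases hb : (b : ZMod p) = 0
  · rw [hb] at h
    refine ⟨?_, hb⟩
    simpa using h
  · exfalso
    have := ZMod.exists_sq_eq_neg_one_iff (p := p)
    refine this.1 ⟨a / (2 * b), ?_⟩ h4
    field_simp
    linear_combination -h

lemma inert2 {p : ℕ} (hp : p.Prime) (h8 : p % 8 = 5 ∨ p % 8 = 7) (a b : ℤ)
    (h : (p : ℤ) ∣ a ^ 2 + 2 * b ^ 2) : (p : ℤ) ∣ a ∧ (p : ℤ) ∣ b := by
  have := Fact.mk hp
  simp only [← ZMod.intCast_zmod_eq_zero_iff_dvd] at h ⊢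
  push_cast at h
  by_cases hb : (b : ZMod p) = 0
  · rw [hb] at h
    refine ⟨?_, hb⟩
    simpa using h
  · exfalso
    have := (ZMod.exists_sq_eq_neg_two_iff (p := p) (by rintro rfl; simp at h8)).1 ⟨a / b, by
      field_simp
      linear_combination -h⟩
    omega

lemma not_dvd_of_choose {F : Type*} [Field F] {p : ℕ} [CharP F p] (m : ℤ) (s : ℕ) (C : ℕ)
    (h : (2 * m : F) = -((-1) ^ s * (C : F))) (hC : ¬ p ∣ C) : ¬ (p : ℤ) ∣ m := by
  intro hd
  rw [← CharP.intCast_eq_zero_iff F p] at hd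
  rw [hd] at h
  have : (C : F) = 0 := by
    have h2 : ((-1 : F)) ^ s * C = 0 := by linear_combination h
    rcases mul_eq_zero.1 h2 with h3 | h3
    · exact absurd h3 (pow_ne_zero _ (by simp))
    · exact h3
  exact hC ((CharP.cast_eq_zero_iff F p C).1 this)

lemma match4 {F : Type*} [Field F] {p : ℕ} [CharP F p] (hp : p.Prime) {r n : ℕ}
    (hq : p ^ r = 8 * n + 1) (hodd : p % 2 = 1) {m b e f : ℤ} (h1 : m ^ 2 + 4 * b ^ 2 = (p : ℤ) ^ r)
    (h2 : e ^ 2 + 4 * f ^ 2 = (p : ℤ) ^ r) (hm : m % 4 = 3) (he : e % 4 = 1)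
    (hpe : p % 4 = 1 → ¬ (p : ℤ) ∣ e)
    (h : (2 * m : F) = -((-1) ^ (2 * n) * ((4 * n).choose (2 * n) : F))) : m = -e := by
  have : m ^ 2 = e ^ 2 := by
    rcases (show p % 4 = 1 ∨ p % 4 = 3 by omega) with h4 | h4
    · have hn := nd4 hp h4 r (2 * n) (by omega)
      rw [show 2 * (2 * n) = 4 * n by ring] at hn
      exact uniq_split hp r (c' := 2) (by norm_num) (by norm_num) hodd h1 h2
        (not_dvd_of_choose m _ _ h hn) (hpe h4)
    · have hi := inert hp (by norm_num) (inert4 hp h4) r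
      rw [hi _ _ h1, hi _ _ h2]
  rcases sq_eq_sq_iff_eq_or_eq_neg.1 this with h | h
  · omega
  · exact h

lemma match2 {F : Type*} [Field F] {p : ℕ} [CharP F p] (hp : p.Prime) {r n : ℕ}
    (hq : p ^ r = 8 * n + 1) (hodd : p % 2 = 1) {m b u v : ℤ} (h1 : m ^ 2 + 2 * b ^ 2 = (p : ℤ) ^ r)
    (h2 : u ^ 2 + 2 * v ^ 2 = (p : ℤ) ^ r) (hm : m % 4 = 3) (hu : u % 4 = 3)
    (hpu : (p % 8 = 1 ∨ p % 8 = 3) → ¬ (p : ℤ) ∣ u)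
    (h : (2 * m : F) = -((-1) ^ n * ((4 * n).choose n : F))) : m = u := by
  have : m ^ 2 = u ^ 2 := by
    by_cases h8 : p % 8 = 1 ∨ p % 8 = 3
    · have hn : ¬ p ∣ (4 * n).choose n := by
        rcases h8 with h8 | h8
        · exact nd8 hp h8 r n hq
        · rcases Nat.even_or_odd' r with ⟨s, hs | hs⟩
          · rw [hs, pow_mul] at hq
            exact nd83 hp h8 s n hq
          · exfalso
            have : p ^ r % 8 = 3 := by
              rw [hs, pow_succ, pow_mul, Nat.mul_mod, Nat.pow_mod, Nat.pow_mod p, h8]; simp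
            omega
      exact uniq_split hp r (c' := 1) (by norm_num) (by norm_num) hodd h1 h2
        (not_dvd_of_choose m _ _ h hn) (hpu h8)
    · have hi := inert hp (by norm_num) (inert2 hp (by omega)) r
      rw [hi _ _ h1, hi _ _ h2]
  rcases sq_eq_sq_iff_eq_or_eq_neg.1 this with h | h
  · exact h
  · omega

end PartF2

section PartF3
variable {F : Type*} [Field F] [Fintype F]

lemma exists_sqrt_char (hF : ringChar F ≠ 2) {n : ℕ} (hn : Fintype.card F = 8 * n + 1)
    {χ : MulChar F ℂ} (hχ : orderOf χ = 4) : ∃ ω : MulChar F ℂ, orderOf ω = 8 ∧ χ = ω ^ 2 := by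
  obtain ⟨E⟩ := MulChar.mulEquiv_units F ℂ
  have h : IsSquare (E χ) := by
    rw [FiniteField.unit_isSquare_iff hF, hn, show (8 * n + 1) / 2 = 4 * n by omega, pow_mul,
      ← map_pow, ← hχ, pow_orderOf_eq_one, map_one, one_pow]
  obtain ⟨w, hw⟩ := h
  have hsq : χ = (E.symm w) ^ 2 := by
    rw [← map_pow, MulEquiv.eq_symm_apply, hw, sq]
  refine ⟨E.symm w, ?_, hsq⟩
  have h2 := Fact.mk Nat.prime_two
  have := orderOf_eq_prime_pow (p := 2) (n := 2) (x := E.symm w) ?_ ?_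
  · simpa using this
  · rw [pow_two 2, pow_mul, ← hsq]
    intro h
    have := orderOf_le_of_pow_eq_one (by norm_num) h
    omega
  · rw [show 2 ^ (2 + 1) = 2 * 4 by norm_num, pow_mul, ← hsq, ← hχ, pow_orderOf_eq_one]

lemma bracket_eq (q p r : ℕ) (e f u v : ℤ) (hp : p.Prime) (hqpr : q = p ^ r)
    (hq8 : q % 8 = 1)
    (hef : (q : ℤ) = e ^ 2 + 4 * f ^ 2) (he4 : e % 4 = 1)
    (hpe : p % 4 = 1 → ¬ (p : ℤ) ∣ e)
    (huv : (q : ℤ) = u ^ 2 + 2 * v ^ 2) (hu4 : u % 4 = 3)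
    (hpu : (p % 8 = 1 ∨ p % 8 = 3) → ¬ (p : ℤ) ∣ u)
    (hF : Fintype.card F = q)
    (χ₄ : MulChar F ℂ) (hχ₄ : orderOf χ₄ = 4)
    (φ : MulChar F ℂ) (hφ : orderOf φ = 2) :
    1024 * (NN F : ℂ) = 
        ((q : ℂ) ^ 2 - 2 * (q : ℂ) * (15 * (e : ℂ) + 101) + 304 * (e : ℂ) ^ 2 +
          (930 - 40 * (u : ℂ)) * (e : ℂ) + 801 + 120 * (u : ℂ) ^ 2 +
          12 * (q : ℂ) ^ 2 * hyp3F2 χ₄ χ₄ (χ₄.ringHomComp (starRingEnd ℂ)) 1 1 +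
          30 * (q : ℂ) ^ 2 * hyp3F2 χ₄ φ φ 1 1) := by
  classical
  obtain ⟨n, hn⟩ : ∃ n, q = 8 * n + 1 := ⟨q / 8, by omega⟩
  have hcard : Fintype.card F = 8 * n + 1 := by rw [hF, hn]
  have hr : r ≠ 0 := by
    rintro rfl
    have := Fintype.one_lt_card (α := F)
    simp at hqpr
    omega
  have hodd : p % 2 = 1 := by
    rcases hp.eq_two_or_odd with h | h
    · exfalso
      have : p ∣ q := hqpr ▸ dvd_pow_self p hr
      rw [h] at this
      omega
    · exact h
  have hchar : CharP F p := by
    obtain ⟨p', hp'⟩ := CharP.exists F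
    obtain ⟨k, hk1, hk2⟩ := FiniteField.card F p'
    have : p = p' := by
      have h : p ∣ p' ^ (k : ℕ) := by
        rw [← hk2, hF, hqpr]; exact dvd_pow_self p hr
      exact (Nat.prime_dvd_prime_iff_eq hp hk1).1 (hp.dvd_of_dvd_pow h)
    rwa [this]
  have hF2 : ringChar F ≠ 2 := by
    rw [ringChar.eq F p]; omega
  obtain ⟨ω, ho, hω⟩ := exists_sqrt_char hF2 hcard hχ₄
  have hφχ : φ = χ₄ ^ 2 := by
    have h2 : orderOf (χ₄ ^ 2) = 2 := by
      rw [orderOf_pow, hχ₄]; norm_num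
    refine MulChar.ext fun a => ?_
    rw [quad_values hφ, quad_values h2]
  have hm : χ₄ (-1) = 1 := by
    rw [hω, MulChar.pow_apply' _ (by norm_num), ← map_pow]; simp
  have h20 : (2 : F) ≠ 0 := two_ne hF2
  have h4 : χ₄ 4 = 1 := by
    have h1 : χ₄ 4 = φ 2 := by
      rw [hφχ, MulChar.pow_apply' _ (by norm_num), ← map_pow]; norm_num
    have h2 : IsSquare (2 : F) := by
      rw [FiniteField.isSquare_two_iff]; omega
    rw [h1, quad_values hφ, (quadraticChar_one_iff_isSquare h20).2 h2]; simp
  obtain ⟨t1, t2, t3, t4, hpP, hjj, hj3⟩ := TT_vals ho hF2 (hω ▸ h4) (hω ▸ hm) χ₄ hω _ _ _ _ rfl rfl rfl rfl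
  have hQ : ∀ a : ℤ, a = Fintype.card F → a = (p : ℤ) ^ r := by
    intro a ha; rw [ha, hF, hqpr]; push_cast; rfl
  obtain ⟨⟨m, b, a1, a2, a3, a4⟩, ⟨m', b', b1, b2, b3, b4⟩⟩ :=
    jacobi_arith ho hF2 n hcard χ₄ hω _ _ _ _ rfl rfl rfl rfl hpP hjj hj3
  have hq' : p ^ r = 8 * n + 1 := by rw [← hqpr, hn]
  have me := match4 hp hq' hodd (hQ _ a2) (hQ _ (by rw [hF, hef])) a3 he4 hpe a4
  have mu := match2 hp hq' hodd (hQ _ b2) (hQ _ (by rw [hF, huv])) b3 hu4 hpu b4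
  have hmi : (χ₄⁻¹) (-1) = 1 := by
    rw [← mc_inv, inv_neg, inv_one, hm]
  have hmφ : φ (-1) = 1 := by
    rw [hφχ, MulChar.pow_apply' _ (by norm_num), hm, one_pow]
  have y1 := hyp_eq χ₄ χ₄ χ₄⁻¹ hm hm hmi
  have y2 := hyp_eq χ₄ φ φ hm hmφ hmφ
  have x4 : χ₄ ^ 4 = 1 := by rw [← hχ₄, pow_orderOf_eq_one]
  have i1 : χ₄⁻¹ = χ₄ ^ 3 := by have := inv_pow4 x4 1; simpa using this
  have i2 : φ⁻¹ = χ₄ ^ 2 := by have := inv_pow4 x4 2; rw [hφχ]; simpa using this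
  have y1' : (Fintype.card F : ℂ) ^ 2 * hyp3F2 χ₄ χ₄ χ₄⁻¹ 1 1 =
      TT (χ₄ ^ 1) (χ₄ ^ 1) (χ₄ ^ 3) (χ₄ ^ 1) (χ₄ ^ 3) := by
    rw [y1, inv_inv, i1, pow_one]
  have y2' : (Fintype.card F : ℂ) ^ 2 * hyp3F2 χ₄ φ φ 1 1 =
      TT (χ₄ ^ 2) (χ₄ ^ 1) (χ₄ ^ 2) (χ₄ ^ 2) (χ₄ ^ 2) := by
    rw [y2, i2, hφχ, pow_one]
  rw [← sum_TT_eq hχ₄, total_char hχ₄ hm _ _ _ rfl rfl rfl, t1, t2, t3, t4, ← y1', ← y2', mc_star_inv,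
    hF]
  rw [hF] at hpP hjj
  have me' : (m : ℂ) = -e := by rw [me]; push_cast; rfl
  rw [me'] at a1
  rw [mu] at b1
  generalize jacobiSum χ₄ (χ₄ ^ 2) = p at *
  generalize jacobiSum (χ₄ ^ 3) (χ₄ ^ 2) = P at *
  generalize jacobiSum ω (χ₄ ^ 2) = j at *
  generalize jacobiSum (ω ^ 7) (χ₄ ^ 2) = j' at *
  have hP : P = 2 * -e - p := by linear_combination a1
  have hj' : j' = 2 * u - j := by linear_combination b1
  subst hP hj'
  linear_combination (-74) * hpP - 60 * hjj

end PartF3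

section PartG

lemma cliqueCount_mul {V : Type*} [Finite V] (G : SimpleGraph V) (n : ℕ) :
    n.factorial * G.cliqueCount n =
      Nat.card {f : Fin n → V // ∀ i j, i ≠ j → G.Adj (f i) (f j)} := by
  classical
  have := Fintype.ofFinite V
  let T := Σ s : {s : Finset V // G.IsNClique n s}, (Fin n ≃ s.1)
  have hT : Nat.card T = n.factorial * G.cliqueCount n := by
    have h1 : ∀ s : {s : Finset V // G.IsNClique n s}, Nat.card (Fin n ≃ s.1) = n.factorial := by
      intro s
      have hc : Fintype.card s.1 = n := by rw [Fintype.card_coe]; exact s.2.card_eq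
      rw [Nat.card_eq_fintype_card, Fintype.card_equiv (Fintype.equivFinOfCardEq hc).symm]
      simp
    rw [Nat.card_sigma, Finset.sum_congr rfl fun s _ => h1 s, SimpleGraph.cliqueCount,
      Nat.card_eq_fintype_card]
    simp [mul_comm]
  rw [← hT]
  refine Nat.card_congr (Equiv.ofBijective (fun t => ⟨fun i => (t.2 i : V), ?_⟩) ⟨?_, ?_⟩)
  · intro i j hij
    refine t.1.2.isClique (t.2 i).2 (t.2 j).2 ?_
    intro h
    exact hij (t.2.injective (Subtype.ext h))
  · rintro ⟨⟨s, hs⟩, e⟩ ⟨⟨s', hs'⟩, e'⟩ h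
    have h' : ∀ i, (e i : V) = e' i := fun i => congrFun (congrArg Subtype.val h) i
    have : s = s' := by
      ext x
      constructor
      · intro hx
        obtain ⟨i, hi⟩ := e.surjective ⟨x, hx⟩
        have := h' i
        rw [hi] at this
        simp only at this
        rw [this]; exact (e' i).2
      · intro hx
        obtain ⟨i, hi⟩ := e'.surjective ⟨x, hx⟩
        have := h' i
        rw [hi] at this
        simp only at this
        rw [← this]; exact (e i).2
    subst this
    have : e = e' := Equiv.ext fun i => Subtype.ext (h' i)
    rw [this]
  · rintro ⟨f, hf⟩
    have hinj : Function.Injective f := by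
      intro i j hij
      by_contra hne
      exact (hf i j hne).ne hij
    have hcl : G.IsNClique n (Finset.univ.image f) := by
      rw [SimpleGraph.isNClique_iff]
      constructor
      · intro x hx y hy hxy
        simp only [Finset.coe_image, Finset.coe_univ, Set.image_univ, Set.mem_range] at hx hy
        obtain ⟨i, rfl⟩ := hx
        obtain ⟨j, rfl⟩ := hy
        exact hf i j fun h => hxy (by rw [h])
      · rw [Finset.card_image_of_injective _ hinj]; simp
    refine ⟨⟨⟨_, hcl⟩, Equiv.ofBijective (fun i => ⟨f i, by simp⟩) ⟨?_, ?_⟩⟩, ?_⟩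
    · intro i j hij
      exact hinj (congrArg Subtype.val hij)
    · rintro ⟨x, hx⟩
      simp only [Finset.mem_image, Finset.mem_univ, true_and] at hx
      obtain ⟨i, hi⟩ := hx
      exact ⟨i, Subtype.ext hi⟩
    · rfl

lemma IsP4.mul {R : Type*} [CommRing R] {a b : R} (ha : IsP4 a) (hb : IsP4 b) : IsP4 (a * b) := by
  obtain ⟨x, rfl⟩ := ha
  obtain ⟨y, rfl⟩ := hb
  exact ⟨x * y, by push_cast; ring⟩

lemma IsP4.ne_zero {F : Type*} [Field F] {a : F} (ha : IsP4 a) : a ≠ 0 := by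
  obtain ⟨x, rfl⟩ := ha
  exact pow_ne_zero _ x.ne_zero

lemma IsP4.mul_iff {F : Type*} [Field F] {a b : F} (ha : IsP4 a) : IsP4 (a * b) ↔ IsP4 b := by
  refine ⟨fun h => ?_, fun h => ha.mul h⟩
  have h0 := ha.ne_zero
  obtain ⟨x, hx⟩ := ha
  have : b = ((x⁻¹ : Fˣ) : F) ^ 4 * (a * b) := by
    rw [hx]; push_cast; field_simp
  rw [this]
  exact IsP4.mul ⟨_, rfl⟩ h

variable {R F : Type*} [CommRing R] [Fintype R] [Field F]

lemma isP4_lift (ρ : R →+* F) (hs : Function.Surjective ρ) (hu : ∀ x, ρ x ≠ 0 → IsUnit x)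
    (h2 : (2 : F) ≠ 0) (z : R) : IsP4 (ρ z) ↔ IsP4 z := by
  constructor
  · rintro ⟨w, hw⟩
    obtain ⟨y, hy⟩ := hs w
    obtain ⟨y', hy'⟩ := hu y (by rw [hy]; exact w.ne_zero)
    let m : {x : R // ρ x = 1} → {x : R // ρ x = 1} := fun x => ⟨x.1 ^ 4, by rw [map_pow, x.2, one_pow]⟩
    have hinj : Function.Injective m := by
      rintro ⟨a, ha⟩ ⟨b, hb⟩ h
      have h : a ^ 4 = b ^ 4 := congrArg Subtype.val h
      have u1 : IsUnit (a + b) := hu _ (by rw [map_add, ha, hb, one_add_one_eq_two]; exact h2)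
      have u2 : IsUnit (a ^ 2 + b ^ 2) := hu _ (by
        rw [map_add, map_pow, map_pow, ha, hb, one_pow, one_add_one_eq_two]; exact h2)
      have h3 : (a - b) * ((a + b) * (a ^ 2 + b ^ 2)) = 0 := by linear_combination h
      rw [(u1.mul u2).mul_left_eq_zero] at h3
      exact Subtype.ext (sub_eq_zero.1 h3)
    have hsurj := Finite.surjective_of_injective hinj
    have hyy : ρ (y'⁻¹ : Rˣ) * (w : F) = 1 := by
      rw [← hy, ← hy', ← map_mul]; simp
    obtain ⟨⟨t, ht⟩, htt⟩ := hsurj ⟨(y'⁻¹ : Rˣ) ^ 4 * z, by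
      rw [map_mul, map_pow, hw, ← mul_pow, hyy, one_pow]⟩
    have htt : t ^ 4 = (y'⁻¹ : Rˣ) ^ 4 * z := congrArg Subtype.val htt
    obtain ⟨t', rfl⟩ := hu t (by rw [ht]; exact one_ne_zero)
    refine ⟨y' * t', ?_⟩
    rw [Units.val_mul, mul_pow, htt, ← mul_assoc, ← mul_pow]; simp
  · rintro ⟨w, rfl⟩
    exact ⟨Units.map ρ w, by simp⟩

lemma adj_iff (ρ : R →+* F) (hs : Function.Surjective ρ) (hu : ∀ x, ρ x ≠ 0 → IsUnit x)
    (h2 : (2 : F) ≠ 0) (hm : IsP4 (-1 : F)) (x y : R) :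
    (unitaryCayleyGraph R 4).Adj x y ↔ IsP4 (ρ y - ρ x) := by
  unfold unitaryCayleyGraph
  rw [SimpleGraph.fromRel_adj, ← map_sub]
  have h1 : (∃ u : Rˣ, y - x = (u : R) ^ 4) ↔ IsP4 (ρ (y - x)) := (isP4_lift ρ hs hu h2 _).symm
  have h3 : (∃ u : Rˣ, x - y = (u : R) ^ 4) ↔ IsP4 (ρ (y - x)) := by
    rw [← hm.mul_iff, ← map_one ρ, ← map_neg, ← map_mul, show -1 * (y - x) = x - y by ring]
    exact (isP4_lift ρ hs hu h2 _).symm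
  rw [h1, h3, or_self]
  constructor
  · exact fun h => h.2
  · refine fun h => ⟨?_, h⟩
    rintro rfl
    exact h.ne_zero (by simp)

lemma card_lift {ι : Type*} [Fintype ι] (ρ : R →+* F) (hs : Function.Surjective ρ)
    (P : (ι → F) → Prop) :
    Nat.card {f : ι → R // P fun i => ρ (f i)} =
      Nat.card {x : R // ρ x = 0} ^ Fintype.card ι * Nat.card {g : ι → F // P g} := by
  choose s hs using hs
  have E : {f : ι → R // P fun i => ρ (f i)} ≃ (ι → {x : R // ρ x = 0}) × {g : ι → F // P g} :=
    { toFun := fun f => (fun i => ⟨f.1 i - s (ρ (f.1 i)), by rw [map_sub, hs, sub_self]⟩,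
        ⟨fun i => ρ (f.1 i), f.2⟩)
      invFun := fun t => ⟨fun i => t.1 i + s (t.2.1 i), by
        have : (fun i => ρ (t.1 i + s (t.2.1 i))) = t.2.1 := by
          funext i; rw [map_add, (t.1 i).2, hs, zero_add]
        rw [this]; exact t.2.2⟩
      left_inv := by
        rintro ⟨f, hf⟩
        apply Subtype.ext
        funext i
        simp
      right_inv := by
        rintro ⟨a, g, hg⟩
        refine Prod.ext ?_ ?_
        · funext i
          apply Subtype.ext
          simp [(a i).2, hs]
        · apply Subtype.ext
          funext i
          simp [(a i).2, hs] }
  rw [Nat.card_congr E, Nat.card_prod, Nat.card_fun, Nat.card_eq_fintype_card (α := ι)]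

lemma card_P4 {F : Type*} [Field F] [Fintype F] {χ : MulChar F ℂ} (ho : orderOf χ = 4) :
    (4 : ℂ) * Nat.card {s : F // IsP4 s} = Fintype.card F - 1 := by
  classical
  have h := Finset.sum_congr (rfl : (Finset.univ : Finset F) = Finset.univ) fun z _ => ind4 ho z
  rw [← Finset.mul_sum, Finset.sum_comm] at h
  rw [Nat.card_eq_fintype_card, Fintype.card_subtype]
  have hb : (∑ z : F, if IsP4 z then (1 : ℂ) else 0) = ((Finset.univ.filter (IsP4 (R := F))).card : ℂ) := by
    rw [Finset.sum_boole]
  have hne : ∀ a, 0 < a → a < 4 → ∑ z : F, (χ ^ a) z = 0 := by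
    intro a ha ha4
    apply sum_mc
    intro h
    have := orderOf_le_of_pow_eq_one ha h
    omega
  rw [← hb]
  have h0 : ∑ z : F, (χ ^ 0) z = Fintype.card F - 1 := by
    rw [pow_zero, MulChar.sum_one_eq_card_units, Fintype.card_units,
      Nat.cast_sub Fintype.card_pos]
    simp
  rw [Finset.sum_range_succ, Finset.sum_range_succ, Finset.sum_range_succ, Finset.sum_range_one, h0,
    hne 1 (by norm_num) (by norm_num), hne 2 (by norm_num) (by norm_num),
    hne 3 (by norm_num) (by norm_num)] at h
  rw [← h]; ring

lemma card_N4 {F : Type*} [Field F] [Fintype F] (hm : IsP4 (-1 : F)) :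
    Nat.card {g : Fin 4 → F // ∀ i j, i ≠ j → IsP4 (g j - g i)} =
      Fintype.card F * (Nat.card {s : F // IsP4 s} * NN F) := by
  classical
  have hN : NN F = Nat.card {t : F × F // IsP4 t.1 ∧ IsP4 (1 - t.1) ∧ IsP4 t.2 ∧ IsP4 (1 - t.2) ∧
      IsP4 (t.1 - t.2)} := by
    rw [Nat.card_eq_fintype_card, Fintype.card_subtype, Finset.card_filter, Fintype.sum_prod_type]
    unfold NN
    refine Finset.sum_congr rfl fun x _ => Finset.sum_congr rfl fun y _ => ?_
    congr
  rw [hN, ← Nat.card_eq_fintype_card (α := F), ← Nat.card_prod, ← Nat.card_prod]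
  have hneg : ∀ a b : F, IsP4 (a - b) ↔ IsP4 (b - a) := by
    intro a b
    rw [← hm.mul_iff, show -1 * (a - b) = b - a by ring]
  refine Nat.card_congr
    { toFun := fun g => (g.1 0, ⟨g.1 1 - g.1 0, g.2 0 1 (by decide)⟩,
        ⟨((g.1 2 - g.1 0) / (g.1 1 - g.1 0), (g.1 3 - g.1 0) / (g.1 1 - g.1 0)), ?_⟩)
      invFun := fun t => ⟨![t.1, t.1 + t.2.1, t.1 + t.2.1 * t.2.2.1.1, t.1 + t.2.1 * t.2.2.1.2], ?_⟩
      left_inv := ?_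
      right_inv := ?_ }
  · obtain ⟨g, hg⟩ := g
    have h01 := hg 0 1 (by decide)
    have h0 := h01.ne_zero
    simp only
    refine ⟨?_, ?_, ?_, ?_, ?_⟩
    · rw [← h01.mul_iff, mul_div_cancel₀ _ h0]; exact hg 0 2 (by decide)
    · rw [← h01.mul_iff, mul_sub, mul_div_cancel₀ _ h0]
      convert hg 2 1 (by decide) using 1; ring
    · rw [← h01.mul_iff, mul_div_cancel₀ _ h0]; exact hg 0 3 (by decide)
    · rw [← h01.mul_iff, mul_sub, mul_div_cancel₀ _ h0]
      convert hg 3 1 (by decide) using 1; ring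
    · rw [← h01.mul_iff, mul_sub, mul_div_cancel₀ _ h0, mul_div_cancel₀ _ h0]
      convert hg 3 2 (by decide) using 1; ring
  · obtain ⟨a, ⟨s, hs⟩, ⟨⟨x, y⟩, h1, h2, h3, h4, h5⟩⟩ := t
    simp only at h1 h2 h3 h4 h5
    have sym : ∀ i j : Fin 4, i < j → IsP4 ((![a, a + s, a + s * x, a + s * y] : Fin 4 → F) j -
        (![a, a + s, a + s * x, a + s * y] : Fin 4 → F) i) := by
      intro i j hij
      fin_cases i <;> fin_cases j <;> first | (exfalso; revert hij; decide) | skip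
      · simpa using hs
      · simpa using hs.mul h1
      · simpa using hs.mul h3
      · have := hs.mul ((hneg _ _).1 h2)
        simpa [mul_sub] using this
      · have := hs.mul ((hneg _ _).1 h4)
        simpa [mul_sub] using this
      · have := hs.mul ((hneg _ _).1 h5)
        simpa [mul_sub] using this
    intro i j hij
    rcases lt_or_gt_of_ne hij with h | h
    · exact sym i j h
    · exact (hneg _ _).1 (sym j i h)
  · rintro ⟨g, hg⟩
    have h0 := (hg 0 1 (by decide)).ne_zero
    apply Subtype.ext
    funext i
    fin_cases i
    · simp
    · simp
    · simp [mul_div_cancel₀ _ h0]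
    · simp [mul_div_cancel₀ _ h0]
  · rintro ⟨a, ⟨s, hs⟩, ⟨⟨x, y⟩, h⟩⟩
    have h0 := hs.ne_zero
    simp [h0]

end PartG

/-- Let `(R,𝔪)` be a finite commutative local ring with `|𝔪| = q^β` and residue field of size
`q = p^r` (`p` prime), `gcd(4,|R|) = 1` and `q ≡ 1 (mod 8)`. Let `e, f, u, v` be as in the
statement, `χ₄` a multiplicative character of `𝔽_q` of order `4` and `φ` the character of
order `2`. Then `K_4(G_R(4)) = (q^(4β+1)(q-1)/(2¹⁵·3)) · [q² - 2q(15e+101) + 304e² +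
(930-40u)e + 801 + 120u² + 12q²·₃F₂(χ₄,χ₄,χ̄₄;ε,ε;1)_q + 30q²·₃F₂(χ₄,φ,φ;ε,ε;1)_q]`. -/
theorem fourCliqueCount_unitaryCayley_four (R : Type*) [CommRing R] [IsLocalRing R]
    [Fintype R] (q β p r : ℕ) (e f u v : ℤ) (hp : p.Prime) (hqpr : q = p ^ r)
    (hm : Nat.card (IsLocalRing.maximalIdeal R) = q ^ β)
    (hq : Nat.card (IsLocalRing.ResidueField R) = q)
    (hk : Nat.gcd 4 (Fintype.card R) = 1)
    (hq8 : q % 8 = 1)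
    (hef : (q : ℤ) = e ^ 2 + 4 * f ^ 2) (he4 : e % 4 = 1)
    (hpe : p % 4 = 1 → ¬ (p : ℤ) ∣ e)
    (huv : (q : ℤ) = u ^ 2 + 2 * v ^ 2) (hu4 : u % 4 = 3)
    (hpu : (p % 8 = 1 ∨ p % 8 = 3) → ¬ (p : ℤ) ∣ u)
    (F : Type*) [Field F] [Fintype F] (hF : Fintype.card F = q)
    (χ₄ : MulChar F ℂ) (hχ₄ : orderOf χ₄ = 4)
    (φ : MulChar F ℂ) (hφ : orderOf φ = 2) :
    (2 ^ 15 * 3 : ℂ) * ((unitaryCayleyGraph R 4).cliqueCount 4 : ℂ) =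
      (q : ℂ) ^ (4 * β + 1) * ((q : ℂ) - 1) *
        ((q : ℂ) ^ 2 - 2 * (q : ℂ) * (15 * (e : ℂ) + 101) + 304 * (e : ℂ) ^ 2 +
          (930 - 40 * (u : ℂ)) * (e : ℂ) + 801 + 120 * (u : ℂ) ^ 2 +
          12 * (q : ℂ) ^ 2 * hyp3F2 χ₄ χ₄ (χ₄.ringHomComp (starRingEnd ℂ)) 1 1 +
          30 * (q : ℂ) ^ 2 * hyp3F2 χ₄ φ φ 1 1) := by
  classical
  have hfin : Finite (IsLocalRing.ResidueField R) :=
    Finite.of_surjective _ (IsLocalRing.residue_surjective (R := R))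
  have : Fintype (IsLocalRing.ResidueField R) := Fintype.ofFinite _
  have hcard : Fintype.card (IsLocalRing.ResidueField R) = Fintype.card F := by
    rw [← Nat.card_eq_fintype_card, hq, hF]
  let E := FiniteField.ringEquivOfCardEq hcard
  let ρ : R →+* F := (E : IsLocalRing.ResidueField R →+* F).comp (IsLocalRing.residue R)
  have hs : Function.Surjective ρ := E.surjective.comp IsLocalRing.residue_surjective
  have hz : ∀ x, ρ x = 0 ↔ x ∈ IsLocalRing.maximalIdeal R := by
    intro x
    rw [← IsLocalRing.residue_eq_zero_iff]
    exact map_eq_zero_iff E E.injective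
  have hu : ∀ x, ρ x ≠ 0 → IsUnit x := by
    intro x hx
    by_contra h
    exact hx ((hz x).2 h)
  have hF2 : ringChar F ≠ 2 := by
    intro h
    have := FiniteField.even_card_iff_char_two.1 h
    omega
  have h2 : (2 : F) ≠ 0 := two_ne hF2
  obtain ⟨n, hn⟩ : ∃ n, Fintype.card F = 8 * n + 1 := ⟨q / 8, by omega⟩
  obtain ⟨ω, -, hω⟩ := exists_sqrt_char hF2 hn hχ₄
  have hm1 : IsP4 (-1 : F) := by
    refine (char_eq_one_iff hχ₄ (-1)).1 ?_
    rw [hω, MulChar.pow_apply' _ (by norm_num), ← map_pow]; simp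
  have c1 := cliqueCount_mul (unitaryCayleyGraph R 4) 4
  simp only [adj_iff ρ hs hu h2 hm1] at c1
  have c2 := card_lift (ι := Fin 4) ρ hs (fun g => ∀ i j, i ≠ j → IsP4 (g j - g i))
  have c3 : Nat.card {x : R // ρ x = 0} = q ^ β := by
    rw [← hm]
    exact Nat.card_congr (Equiv.subtypeEquivRight hz)
  rw [c2, c3, card_N4 hm1, Fintype.card_fin, hF] at c1
  have c4 := card_P4 hχ₄
  rw [hF] at c4
  rw [← bracket_eq q p r e f u v hp hqpr hq8 hef he4 hpe huv hu4 hpu hF χ₄ hχ₄ φ hφ]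
  have c5 := congrArg (fun k : ℕ => (k : ℂ)) c1
  simp only [show Nat.factorial 4 = 24 by rfl] at c5
  push_cast at c5
  rw [show (q : ℂ) ^ (4 * β + 1) = ((q : ℂ) ^ β) ^ 4 * q by ring]
  linear_combination 4096 * c5 + 1024 * ((q : ℂ) ^ β) ^ 4 * q * (NN F) * c4
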